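/- Let A be a commutative noetherian local ring with either dim A/𝔞 ≤ 2 or dim A = 3, let x = x_1,…,x_t ∈ 𝔞, and let M be an A-module with Supp_A M ⊆ V(𝔞). If Ext_A^i(A/𝔞, H^j(x,M)) is finitely generated for all i ≤ 2 and all j ≤ 2, then M is 𝔞-cofinite. -/

import Mathlib

open CategoryTheory Limits

noncomputable section

variable {A : Type} [CommRing A]

/-- The `i`-th term of the Koszul cochain complex `Hom_A(K_•(x), M)`. -/
abbrev KoszulCochain {t : ℕ} (x : Fin t → A) (M : Type) [AddCommGroup M] [Module A M]
    (i : ℕ) : Type :=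
  {s : Finset (Fin t) // s.card = i} → M

/-- The Koszul cochain differential. -/
def koszulD {t : ℕ} (x : Fin t → A) (M : Type) [AddCommGroup M] [Module A M] (i : ℕ) :
    KoszulCochain x M i →ₗ[A] KoszulCochain x M (i + 1) :=
  LinearMap.pi fun s => ∑ j ∈ s.1.attach,
    (((-1 : A) ^ ((s.1.filter (fun k => k < j.1)).card)) * x j.1) •
      (LinearMap.proj
        (⟨s.1.erase j.1, by simp [Finset.card_erase_of_mem j.2, s.2]⟩ :
          {s : Finset (Fin t) // s.card = i}) :
        KoszulCochain x M i →ₗ[A] M)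

/-- The boundaries in degree `i` of the Koszul cochain complex. -/
def koszulBoundary {t : ℕ} (x : Fin t → A) (M : Type) [AddCommGroup M] [Module A M] :
    (i : ℕ) → Submodule A (KoszulCochain x M i)
  | 0 => ⊥
  | j + 1 => LinearMap.range (koszulD x M j)

/-- The `i`-th Koszul cohomology `H^i(x, M)` of `M` with respect to `x`. -/
abbrev KoszulCohomology {t : ℕ} (x : Fin t → A) (M : Type) [AddCommGroup M] [Module A M]
    (i : ℕ) : Type :=
  LinearMap.ker (koszulD x M i) ⧸
    (koszulBoundary x M i).comap (LinearMap.ker (koszulD x M i)).subtype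

/-- `Ext_A^i(A/𝔞, M)` as an `A`-module. -/
abbrev extQuot (𝔞 : Ideal A) (M : Type) [AddCommGroup M] [Module A M] (i : ℕ) : Type :=
  ↥(((_root_.Ext A (ModuleCat A) i).obj
    (Opposite.op (ModuleCat.of A (A ⧸ 𝔞)))).obj (ModuleCat.of A M))

/-- `M` is an `𝔞`-cofinite `A`-module: `Supp M ⊆ V(𝔞)` and all `Ext_A^i(A/𝔞, M)`
are finitely generated. -/
def IsCofinite (𝔞 : Ideal A) (M : Type) [AddCommGroup M] [Module A M] : Prop :=
  Module.support A M ⊆ PrimeSpectrum.zeroLocus (𝔞 : Set A) ∧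
    ∀ i : ℕ, Module.Finite A (extQuot 𝔞 M i)

namespace CF

section ExtBasics

variable (A) in
/-- Ext groups -/
abbrev XT (N M : Type) [AddCommGroup N] [Module A N] [AddCommGroup M] [Module A M] (i : ℕ) : Type :=
  Abelian.Ext (ModuleCat.of A N) (ModuleCat.of A M) i

variable (A) in
/-- Finiteness of Ext -/
def EF (N M : Type) [AddCommGroup N] [Module A N] [AddCommGroup M] [Module A M] (i : ℕ) : Prop :=
  Module.Finite A (XT A N M i)

variable {N N₁ N₂ N₃ M M₁ M₂ M₃ : Type} [AddCommGroup N] [Module A N] [AddCommGroup M] [Module A M]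
  [AddCommGroup N₁] [Module A N₁] [AddCommGroup M₁] [Module A M₁]
  [AddCommGroup N₂] [Module A N₂] [AddCommGroup M₂] [Module A M₂]
  [AddCommGroup N₃] [Module A N₃] [AddCommGroup M₃] [Module A M₃]

variable (N) in
/-- covariant functoriality -/
def post (f : M₁ →ₗ[A] M₂) (i : ℕ) : XT A N M₁ i →ₗ[A] XT A N M₂ i :=
  (Abelian.Ext.mk₀ (ModuleCat.ofHom f)).postcompOfLinear A (ModuleCat.of A N) (add_zero i)

variable (M) in
/-- contravariant functoriality -/
def pre (f : N₁ →ₗ[A] N₂) (i : ℕ) : XT A N₂ M i →ₗ[A] XT A N₁ M i :=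
  (Abelian.Ext.mk₀ (ModuleCat.ofHom f)).precompOfLinear A (ModuleCat.of A M) (zero_add i)

theorem post_apply (f : M₁ →ₗ[A] M₂) (i : ℕ) (x : XT A N M₁ i) :
    post N f i x = x.comp (Abelian.Ext.mk₀ (ModuleCat.ofHom f)) (add_zero i) := rfl

theorem pre_apply (f : N₁ →ₗ[A] N₂) (i : ℕ) (x : XT A N₂ M i) :
    pre M f i x = (Abelian.Ext.mk₀ (ModuleCat.ofHom f)).comp x (zero_add i) := rfl

theorem post_comp (f : M₁ →ₗ[A] M₂) (g : M₂ →ₗ[A] M₃) (i : ℕ) (x : XT A N M₁ i) :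
    post N (g ∘ₗ f) i x = post N g i (post N f i x) := by
  simp only [post_apply, ModuleCat.ofHom_comp, Abelian.Ext.comp_assoc_of_second_deg_zero,
    Abelian.Ext.mk₀_comp_mk₀]

theorem pre_comp (f : N₁ →ₗ[A] N₂) (g : N₂ →ₗ[A] N₃) (i : ℕ) (x : XT A N₃ M i) :
    pre M (g ∘ₗ f) i x = pre M f i (pre M g i x) := by
  simp only [pre_apply, ModuleCat.ofHom_comp, ← Abelian.Ext.mk₀_comp_mk₀,
    Abelian.Ext.comp_assoc_of_second_deg_zero]

theorem post_id (i : ℕ) (x : XT A N M i) : post N (LinearMap.id : M →ₗ[A] M) i x = x := by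
  simp [post_apply]

theorem pre_id (i : ℕ) (x : XT A N M i) : pre M (LinearMap.id : N →ₗ[A] N) i x = x := by
  simp [pre_apply]

theorem post_add (f g : M₁ →ₗ[A] M₂) (i : ℕ) : post N (f + g) i = post N f i + post N g i := by
  ext x
  simp only [post_apply, LinearMap.add_apply, ModuleCat.ofHom_add, Abelian.Ext.mk₀_add,
    Abelian.Ext.comp_add]

theorem post_smul (r : A) (f : M₁ →ₗ[A] M₂) (i : ℕ) : post N (r • f) i = r • post N f i := by
  ext x
  have : ModuleCat.ofHom (r • f) = r • ModuleCat.ofHom f := rfl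
  simp only [post_apply, LinearMap.smul_apply, this, Abelian.Ext.mk₀_smul, Abelian.Ext.comp_smul]

theorem pre_smul (r : A) (f : N₁ →ₗ[A] N₂) (i : ℕ) : pre M (r • f) i = r • pre M f i := by
  ext x
  have : ModuleCat.ofHom (r • f) = r • ModuleCat.ofHom f := rfl
  simp only [pre_apply, LinearMap.smul_apply, this, Abelian.Ext.mk₀_smul, Abelian.Ext.smul_comp]

theorem pre_zero (i : ℕ) : pre M (0 : N₁ →ₗ[A] N₂) i = 0 := by
  have := pre_smul (M := M) (0 : A) (0 : N₁ →ₗ[A] N₂) i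
  simpa using this

theorem post_zero (i : ℕ) : post N (0 : M₁ →ₗ[A] M₂) i = 0 := by
  have := post_smul (N := N) (0 : A) (0 : M₁ →ₗ[A] M₂) i
  simpa using this

/-- annihilators of the first variable kill Ext -/
theorem smul_xt_left {r : A} (hr : ∀ n : N, r • n = 0) (i : ℕ) (x : XT A N M i) : r • x = 0 := by
  have h : r • (LinearMap.id : N →ₗ[A] N) = 0 := by ext n; simp [hr]
  have := pre_smul (M := M) r (LinearMap.id : N →ₗ[A] N) i
  rw [h, pre_zero] at this
  have := LinearMap.congr_fun this x
  simpa [pre_id] using this.symm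

theorem smul_xt_right {r : A} (hr : ∀ n : M, r • n = 0) (i : ℕ) (x : XT A N M i) : r • x = 0 := by
  have h : r • (LinearMap.id : M →ₗ[A] M) = 0 := by ext n; simp [hr]
  have := post_smul (N := N) r (LinearMap.id : M →ₗ[A] M) i
  rw [h, post_zero] at this
  have := LinearMap.congr_fun this x
  simpa [post_id] using this.symm

/-- iso invariance -/
def postEquiv (e : M₁ ≃ₗ[A] M₂) (i : ℕ) : XT A N M₁ i ≃ₗ[A] XT A N M₂ i :=
  LinearEquiv.ofLinearMap (post N e.toLinearMap i) (post N e.symm.toLinearMap i)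
    (by ext x; simp [← post_comp, post_id]) (by ext x; simp [← post_comp, post_id])

def preEquiv (e : N₁ ≃ₗ[A] N₂) (i : ℕ) : XT A N₁ M i ≃ₗ[A] XT A N₂ M i :=
  LinearEquiv.ofLinearMap (pre M e.symm.toLinearMap i) (pre M e.toLinearMap i)
    (by ext x; simp [← pre_comp, pre_id]) (by ext x; simp [← pre_comp, pre_id])

theorem EF.congr_right (e : M₁ ≃ₗ[A] M₂) {i : ℕ} (h : EF A N M₁ i) : EF A N M₂ i := by
  have : Module.Finite A (XT A N M₁ i) := h
  exact Module.Finite.equiv (postEquiv e i)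

theorem EF.congr_left (e : N₁ ≃ₗ[A] N₂) {i : ℕ} (h : EF A N₁ M i) : EF A N₂ M i := by
  have : Module.Finite A (XT A N₁ M i) := h
  exact Module.Finite.equiv (preEquiv e i)

variable (N M) in
def homEquiv : XT A N M 0 ≃ₗ[A] (N →ₗ[A] M) :=
  Abelian.Ext.linearEquiv₀.trans ModuleCat.homLinearEquiv

theorem EF.zero_iff : EF A N M 0 ↔ Module.Finite A (N →ₗ[A] M) :=
  ⟨fun h => by have : Module.Finite A (XT A N M 0) := h; exact Module.Finite.equiv (homEquiv N M),
   fun h => Module.Finite.equiv (homEquiv N M).symm⟩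

theorem EF.of_finite [IsNoetherianRing A] [Module.Finite A N] [Module.Finite A M] (i : ℕ) :
    EF A N M i := by
  have : Module.Finite A (ModuleCat.of A N) := ‹Module.Finite A N›
  have : Module.Finite A (ModuleCat.of A M) := ‹Module.Finite A M›
  exact ModuleCat.finite_ext A _ _ i

/-- short exact sequence -/
structure SES (f : M₁ →ₗ[A] M₂) (g : M₂ →ₗ[A] M₃) : Prop where
  inj : Function.Injective f
  surj : Function.Surjective g
  ex : Function.Exact f g

section
variable {f : M₁ →ₗ[A] M₂} {g : M₂ →ₗ[A] M₃}

theorem SES.comp_zero (h : SES f g) : g ∘ₗ f = 0 := by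
  ext x; exact h.ex.apply_apply_eq_zero x

/-- the short complex -/
def SES.sc (h : SES f g) : ShortComplex (ModuleCat.{0} A) :=
  ShortComplex.mk (ModuleCat.ofHom f) (ModuleCat.ofHom g) (by
    rw [← ModuleCat.ofHom_comp, h.comp_zero]; rfl)

theorem SES.se (h : SES f g) : h.sc.ShortExact := by
  refine ShortComplex.ShortExact.mk' ?_ ?_ ?_
  · exact (ShortComplex.ShortExact.moduleCat_exact_iff_function_exact _).mpr h.ex
  · exact (ModuleCat.mono_iff_injective _).mpr h.inj
  · exact (ModuleCat.epi_iff_surjective _).mpr h.surj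

variable (N) in
def SES.δ (h : SES f g) (i : ℕ) : XT A N M₃ i →ₗ[A] XT A N M₁ (i + 1) :=
  h.se.extClass.postcompOfLinear A (ModuleCat.of A N) rfl

variable (N) in
def SES.δ' (h : SES f g) (i : ℕ) : XT A M₁ N i →ₗ[A] XT A M₃ N (i + 1) :=
  h.se.extClass.precompOfLinear A (ModuleCat.of A N) (add_comm 1 i)

theorem SES.ex2 (h : SES f g) (i : ℕ) : Function.Exact (post N f i) (post N g i) := by
  intro x
  constructor
  · intro hx; exact Abelian.Ext.covariant_sequence_exact₂ _ h.se x hx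
  · rintro ⟨y, rfl⟩
    rw [← post_comp, h.comp_zero, post_zero]; rfl

theorem SES.ex3 (h : SES f g) (i : ℕ) (x : XT A N M₃ i) (hx : h.δ N i x = 0) :
    ∃ y, post N g i y = x :=
  Abelian.Ext.covariant_sequence_exact₃ _ h.se x rfl hx

theorem SES.ex1 (h : SES f g) (i : ℕ) (x : XT A N M₁ (i + 1)) (hx : post N f (i + 1) x = 0) :
    ∃ y, h.δ N i y = x :=
  Abelian.Ext.covariant_sequence_exact₁ _ h.se x hx rfl

theorem SES.ex2' (h : SES f g) (i : ℕ) (x : XT A M₂ N i) (hx : pre N f i x = 0) :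
    ∃ y, pre N g i y = x := Abelian.Ext.contravariant_sequence_exact₂ h.se _ x hx

theorem SES.ex1' (h : SES f g) (i : ℕ) (x : XT A M₁ N i) (hx : h.δ' N i x = 0) :
    ∃ y, pre N f i y = x :=
  Abelian.Ext.contravariant_sequence_exact₁ h.se _ x (add_comm 1 i) hx

theorem SES.ex3' (h : SES f g) (i : ℕ) (x : XT A M₃ N (i + 1)) (hx : pre N g (i + 1) x = 0) :
    ∃ y, h.δ' N i y = x :=
  Abelian.Ext.contravariant_sequence_exact₃ h.se _ x hx (add_comm 1 i)

end

theorem post_injective_zero {f : M₁ →ₗ[A] M₂} (hf : Function.Injective f) :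
    Function.Injective (post N f 0) := by
  have : Mono (ModuleCat.ofHom f) := (ModuleCat.mono_iff_injective _).mpr hf
  exact Abelian.Ext.postcomp_mk₀_injective_of_mono (ModuleCat.of A N) (ModuleCat.ofHom f)

theorem pre_injective_zero {f : N₁ →ₗ[A] N₂} (hf : Function.Surjective f) :
    Function.Injective (pre M f 0) := by
  have : Epi (ModuleCat.ofHom f) := (ModuleCat.epi_iff_surjective _).mpr hf
  exact Abelian.Ext.precomp_mk₀_injective_of_epi (ModuleCat.of A M) (ModuleCat.ofHom f)

/-- middle of an exact sequence, with range -/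
theorem finite_of_ker_range [IsNoetherianRing A] {X Y Z : Type} [AddCommGroup X] [Module A X]
    [AddCommGroup Y] [Module A Y] [AddCommGroup Z] [Module A Z] (f : X →ₗ[A] Y) (g : Y →ₗ[A] Z)
    (hX : Module.Finite A X) (hfg : ∀ y, g y = 0 → ∃ x, f x = y)
    (hZ : Module.Finite A (LinearMap.range g)) :
    Module.Finite A Y := by
  have h1 : Module.Finite A (LinearMap.ker g) := by
    have : IsNoetherian A (LinearMap.range f) := isNoetherian_of_isNoetherianRing_of_finite A _
    have h : LinearMap.ker g ≤ LinearMap.range f := fun y hy => hfg y hy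
    exact Module.Finite.of_injective (Submodule.inclusion h) (Submodule.inclusion_injective h)
  rw [Module.finite_def]
  refine Submodule.fg_of_fg_map_of_fg_inf_ker g ?_ ?_
  · rw [Submodule.map_top]; exact (Submodule.fg_top _).mp hZ.1
  · rw [top_inf_eq]; exact (Submodule.fg_top _).mp h1.1

theorem finite_of_ker [IsNoetherianRing A] {X Y Z : Type} [AddCommGroup X] [Module A X]
    [AddCommGroup Y] [Module A Y] [AddCommGroup Z] [Module A Z] (f : X →ₗ[A] Y) (g : Y →ₗ[A] Z)
    (hX : Module.Finite A X) (hfg : ∀ y, g y = 0 → ∃ x, f x = y)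
    (hZ : Module.Finite A Z) :
    Module.Finite A Y := by
  refine finite_of_ker_range f g hX hfg ?_
  have : IsNoetherian A Z := isNoetherian_of_isNoetherianRing_of_finite A _
  infer_instance

section LES
variable [IsNoetherianRing A] {f : M₁ →ₗ[A] M₂} {g : M₂ →ₗ[A] M₃}

theorem SES.EF2 (h : SES f g) {i : ℕ} (h1 : EF A N M₁ i) (h3 : EF A N M₃ i) : EF A N M₂ i :=
  finite_of_ker (post N f i) (post N g i) h1 (fun y hy => (h.ex2 i y).1 hy) h3

theorem SES.EF3 (h : SES f g) {i : ℕ} (h1 : EF A N M₂ i) (h3 : EF A N M₁ (i + 1)) : EF A N M₃ i :=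
  finite_of_ker (post N g i) (h.δ N i) h1 (h.ex3 i) h3

theorem SES.EF1 (h : SES f g) {i : ℕ} (h1 : EF A N M₃ i) (h3 : EF A N M₂ (i + 1)) :
    EF A N M₁ (i + 1) :=
  finite_of_ker (h.δ N i) (post N f (i + 1)) h1 (h.ex1 i) h3

theorem EF.sub (hf : Function.Injective f) (h : EF A N M₂ 0) : EF A N M₁ 0 := by
  have : Module.Finite A (XT A N M₂ 0) := h
  have : IsNoetherian A (XT A N M₂ 0) := isNoetherian_of_isNoetherianRing_of_finite A _
  exact Module.Finite.of_injective (post N f 0) (post_injective_zero hf)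

theorem SES.EF2' (h : SES f g) {i : ℕ} (h1 : EF A M₁ N i) (h3 : EF A M₃ N i) : EF A M₂ N i :=
  finite_of_ker (pre N g i) (pre N f i) h3 (h.ex2' i) h1

theorem SES.EF1' (h : SES f g) {i : ℕ} (h1 : EF A M₂ N i) (h3 : EF A M₃ N (i + 1)) : EF A M₁ N i :=
  finite_of_ker (pre N f i) (h.δ' N i) h1 (h.ex1' i) h3

theorem SES.EF3' (h : SES f g) {i : ℕ} (h1 : EF A M₁ N i) (h3 : EF A M₂ N (i + 1)) :
    EF A M₃ N (i + 1) :=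
  finite_of_ker (h.δ' N i) (pre N g (i + 1)) h1 (h.ex3' i) h3

theorem EF.sub' (hf : Function.Surjective g) (h : EF A M₂ N 0) : EF A M₃ N 0 := by
  have : Module.Finite A (XT A M₂ N 0) := h
  have : IsNoetherian A (XT A M₂ N 0) := isNoetherian_of_isNoetherianRing_of_finite A _
  exact Module.Finite.of_injective (pre N g 0) (pre_injective_zero hf)

end LES

theorem ses_sub (K : Submodule A M) : SES K.subtype K.mkQ :=
  ⟨K.injective_subtype, K.mkQ_surjective, LinearMap.exact_subtype_mkQ K⟩

theorem ses_ker (f : M₁ →ₗ[A] M₂) (hf : Function.Surjective f) :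
    SES (LinearMap.ker f).subtype f :=
  ⟨Submodule.injective_subtype _, hf, LinearMap.exact_subtype_ker_map f⟩

theorem ses_range (f : M₁ →ₗ[A] M₂) (hf : Function.Injective f) :
    SES f (LinearMap.range f).mkQ :=
  ⟨hf, Submodule.mkQ_surjective _, LinearMap.exact_map_mkQ_range f⟩

/-- If `f` induces zero on Ext -/
theorem EF.of_post_zero [IsNoetherianRing A] (f : M₁ →ₗ[A] M₂) (i : ℕ) (hf : post N f i = 0)
    (hK : EF A N (LinearMap.ker f) i)
    (hQ : ∀ j, j + 1 = i → EF A N (M₂ ⧸ LinearMap.range f) j) : EF A N M₁ i := by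
  refine finite_of_ker_range (post N (LinearMap.ker f).subtype i) (post N f.rangeRestrict i) hK
    ?_ ?_
  · intro y hy
    obtain ⟨x, hx⟩ := ((ses_ker f.rangeRestrict f.surjective_rangeRestrict).ex2 i y).1 hy
    have hk : LinearMap.ker f.rangeRestrict = LinearMap.ker f := LinearMap.ker_rangeRestrict f
    refine ⟨post N (LinearEquiv.ofEq _ _ hk).toLinearMap i x, ?_⟩
    rw [← post_comp, ← hx]; rfl
  · have key : ∀ y, post N (LinearMap.range f).subtype i (post N f.rangeRestrict i y) = 0 := by
      intro y
      rw [← post_comp]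
      have : (LinearMap.range f).subtype ∘ₗ f.rangeRestrict = f := rfl
      rw [this, hf]; rfl
    cases i with
    | zero =>
      have : post N f.rangeRestrict 0 = 0 := by
        ext y
        exact post_injective_zero (Submodule.injective_subtype _) (by rw [key]; simp)
      rw [this, LinearMap.range_zero]
      infer_instance
    | succ j =>
      have hfin : Module.Finite A (XT A N (M₂ ⧸ LinearMap.range f) j) := hQ j rfl
      have : IsNoetherian A (LinearMap.range ((ses_sub (LinearMap.range f)).δ N j)) :=
        isNoetherian_of_isNoetherianRing_of_finite A _
      have h : LinearMap.range (post N f.rangeRestrict (j + 1)) ≤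
          LinearMap.range ((ses_sub (LinearMap.range f)).δ N j) := by
        rintro _ ⟨y, rfl⟩
        exact (ses_sub (LinearMap.range f)).ex1 j _ (key y)
      exact Module.Finite.of_injective (Submodule.inclusion h) (Submodule.inclusion_injective h)

/-- elements of the annihilator times homs induce zero -/
theorem post_eq_zero_of_mem {a : Ideal A} (ha : ∀ r ∈ a, ∀ n : N, r • n = 0) (f : M₁ →ₗ[A] M₂)
    (hf : f ∈ a • (⊤ : Submodule A (M₁ →ₗ[A] M₂))) (i : ℕ) : post N f i = 0 := by
  induction hf using Submodule.smul_induction_on' with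
  | smul r hr g _ =>
    rw [post_smul]; ext x
    exact smul_xt_left (ha r hr) i _
  | add f _ g _ h1 h2 => rw [post_add, h1, h2, add_zero]

theorem EF.of_subsingleton {i : ℕ} (h : Subsingleton (XT A N M i)) : EF A N M i :=
  Module.Finite.of_finite

/-- Ext vanishes if an annihilator of `N` is invertible on `M`. -/
theorem xt_subsingleton {r : A} (hr : ∀ n : N, r • n = 0)
    (hb : Function.Bijective (LinearMap.lsmul A M r)) (i : ℕ) : Subsingleton (XT A N M i) := by
  let e := LinearEquiv.ofBijective _ hb
  have hz : ∀ x : XT A N M i, x = 0 := by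
    intro x
    apply (postEquiv (N := N) e i).injective
    have : post N (LinearMap.lsmul A M r) i x = r • x := by
      have : LinearMap.lsmul A M r = r • LinearMap.id := by ext; simp
      rw [this, post_smul]; simp [post_id]
    change post N (LinearMap.lsmul A M r) i x = postEquiv (N := N) e i 0
    rw [this, smul_xt_left hr]; simp
  exact ⟨fun x y => by rw [hz x, hz y]⟩

end ExtBasics

end CF

namespace CF

/-- comparison map from cocycles -/
def cocycleToExt {X : ModuleCat.{0} A} (P : ProjectiveResolution X) (Y : ModuleCat.{0} A) (n : ℕ) :
    LinearMap.ker ((P.complex.linearYonedaObj A Y).d n (n + 1)).hom →ₗ[A] Abelian.Ext X Y n where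
  toFun f := P.extMk (n := n) (f.1 : P.complex.X n ⟶ Y) (n + 1) rfl f.2
  map_add' f g := (P.add_extMk _ _ _ _ _ _).symm
  map_smul' r f := by
    rw [RingHom.id_apply, Abelian.Ext.smul_eq_comp_mk₀]
    erw [P.extMk_comp_mk₀]
    congr 1

theorem cocycleToExt_surj {X : ModuleCat.{0} A} (P : ProjectiveResolution X) (Y : ModuleCat.{0} A)
    (n : ℕ) : Function.Surjective (cocycleToExt P Y n) := by
  intro α
  obtain ⟨f, hf, rfl⟩ := P.extMk_surjective α (n + 1) rfl
  exact ⟨⟨f, hf⟩, rfl⟩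

theorem extMk_zero_deg {X : ModuleCat.{0} A} (P : ProjectiveResolution X) (Y : ModuleCat.{0} A)
    (f : P.complex.X 0 ⟶ Y) (hf : P.complex.d (0 + 1) 0 ≫ f = 0)
    (h : P.extMk f (0 + 1) rfl hf = 0) : f = 0 := by
  rw [← P.extEquivCohomologyClass.apply_eq_iff_eq,
    P.extEquivCohomologyClass_extMk, P.extEquivCohomologyClass_zero,
    CochainComplex.HomComplex.CohomologyClass.mk_eq_zero_iff] at h
  rw [CochainComplex.HomComplex.Cocycle.toSingleMk_mem_coboundaries_iff _ _ _ _ _ 1 (by simp)] at h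
  obtain ⟨g, hg⟩ := h
  have hz : IsZero (P.cochainComplex.X 1) :=
    CochainComplex.isZero_of_isStrictlyLE _ 0 1 (by simp)
  rw [hz.eq_zero_of_src g, comp_zero] at hg
  rw [← cancel_epi (P.cochainComplexXIso (-(0 : ℕ)) 0 rfl).hom, ← hg, comp_zero]

/-- finiteness transfers -/
theorem ext_finite_iff {X : ModuleCat.{0} A} (Y : ModuleCat.{0} A) (n : ℕ) :
    Module.Finite A ↥(((_root_.Ext A (ModuleCat A) n).obj (Opposite.op X)).obj Y) ↔
      Module.Finite A (Abelian.Ext X Y n) := by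
  let P := projectiveResolution X
  let C := P.complex.linearYonedaObj A Y
  let e1 : ((_root_.Ext A (ModuleCat A) n).obj (Opposite.op X)).obj Y ≅ C.homology n :=
    P.isoExt n Y
  obtain ⟨q, hq⟩ : ∃ q, (ComplexShape.up ℕ).prev n = q := ⟨_, rfl⟩
  let S : ShortComplex (ModuleCat.{0} A) := C.sc' q n (n + 1)
  let e2 : C.homology n ≅ S.homology := (C.homologyIsoSc' _ _ _ hq (by simp))
  let e3 := S.moduleCatHomologyIso
  let T : C.X q →ₗ[A] LinearMap.ker (C.d n (n + 1)).hom :=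
    S.moduleCatToCycles
  let e : ↥(((_root_.Ext A (ModuleCat A) n).obj (Opposite.op X)).obj Y) ≃ₗ[A]
    (LinearMap.ker (C.d n (n + 1)).hom ⧸ LinearMap.range T) := (e1 ≪≫ e2 ≪≫ e3).toLinearEquiv
  have hk : LinearMap.ker (cocycleToExt P Y n) = LinearMap.range T := by
    ext f
    rw [LinearMap.mem_ker]
    cases n with
    | zero =>
      have hT : ∀ g, T g = 0 := by
        intro g
        apply Subtype.ext
        change (C.d _ 0).hom g = 0
        rw [C.shape _ _ (by simp)]; rfl
      have h2 : f ∈ LinearMap.range T ↔ f = 0 := by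
        constructor
        · rintro ⟨g, rfl⟩; exact hT g
        · rintro rfl; exact Submodule.zero_mem _
      rw [h2]
      constructor
      · intro h
        exact Subtype.ext (extMk_zero_deg P Y f.1 f.2 h)
      · rintro rfl; exact map_zero _
    | succ p =>
      refine Iff.trans (P.extMk_eq_zero_iff (n := p + 1) (f.1 : P.complex.X (p + 1) ⟶ Y)
        (p + 1 + 1) rfl f.2 p rfl) ?_
      have hp : q = p := by rw [← hq]; simp
      subst hp
      constructor
      · rintro ⟨g, hg⟩
        exact ⟨g, Subtype.ext hg⟩
      · rintro ⟨g, hg⟩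
        exact ⟨g, congrArg Subtype.val hg⟩
  let e4 := (Submodule.quotEquivOfEq _ _ hk.symm).trans
    ((cocycleToExt P Y n).quotKerEquivOfSurjective (cocycleToExt_surj P Y n))
  exact ⟨fun h => Module.Finite.equiv (e.trans e4), fun h => Module.Finite.equiv (e.trans e4).symm⟩

end CF

namespace CF
open TensorProduct

section BaseChange

variable (B : Type) [CommRing B] [Algebra A B]
  {N M M₁ M₂ M₃ : Type} [AddCommGroup N] [Module A N] [AddCommGroup M] [Module A M]
  [AddCommGroup M₁] [Module A M₁] [AddCommGroup M₂] [Module A M₂] [AddCommGroup M₃] [Module A M₃]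

theorem baseChange_exact {f : M₁ →ₗ[A] M₂} {g : M₂ →ₗ[A] M₃} (h : Function.Exact f g)
    (hg : Function.Surjective g) : Function.Exact (f.baseChange B) (g.baseChange B) :=
  lTensor_exact B h hg

theorem baseChange_surj {g : M₂ →ₗ[A] M₃} 
    (hg : Function.Surjective g) : Function.Surjective (g.baseChange B) :=
  LinearMap.lTensor_surjective B hg

theorem SES.baseChange [Module.Flat A B] {f : M₁ →ₗ[A] M₂} {g : M₂ →ₗ[A] M₃} (h : SES f g) :
    SES (f.baseChange B) (g.baseChange B) :=
  ⟨Module.Flat.lTensor_preserves_injective_linearMap f h.inj, baseChange_surj B h.surj,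
    baseChange_exact B h.ex h.surj⟩

/-- cokernels of isomorphic maps -/
theorem cokEquiv {X Y Z X' Y' Z' : Type} [AddCommGroup X] [Module A X] [AddCommGroup Y] [Module A Y]
    [AddCommGroup Z] [Module A Z] [AddCommGroup X'] [Module A X'] [AddCommGroup Y'] [Module A Y']
    [AddCommGroup Z'] [Module A Z'] (f : X →ₗ[A] Y) (g : Y →ₗ[A] Z) (f' : X' →ₗ[A] Y')
    (g' : Y' →ₗ[A] Z') (h : Function.Exact f g) (h' : Function.Exact f' g')
    (hg : Function.Surjective g) (hg' : Function.Surjective g') (e0 : X ≃ₗ[A] X') (e1 : Y ≃ₗ[A] Y')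
    (hc : ∀ x, e1 (f x) = f' (e0 x)) : Nonempty (Z ≃ₗ[A] Z') := by
  have hk : (LinearMap.ker g).map e1.toLinearMap = LinearMap.ker g' := by
    rw [h.linearMap_ker_eq, h'.linearMap_ker_eq, ← LinearMap.range_comp]
    ext y
    constructor
    · rintro ⟨x, rfl⟩; exact ⟨e0 x, (hc x).symm⟩
    · rintro ⟨x, rfl⟩; exact ⟨e0.symm x, by simp [hc]⟩
  exact ⟨(g.quotKerEquivOfSurjective hg).symm ≪≫ₗ Submodule.Quotient.equiv _ _ e1 hk ≪≫ₗ
    (g'.quotKerEquivOfSurjective hg')⟩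

/-- δ' on homs in degree zero -/
def SES.δh {f : M₁ →ₗ[A] M₂} {g : M₂ →ₗ[A] M₃} (h : SES f g) (M : Type) [AddCommGroup M]
    [Module A M] : (M₁ →ₗ[A] M) →ₗ[A] XT A M₃ M 1 :=
  (h.δ' M 0) ∘ₗ (homEquiv M₁ M).symm.toLinearMap

theorem homEquiv_pre (f : M₁ →ₗ[A] M₂) (x : XT A M₂ M 0) :
    homEquiv M₁ M (pre M f 0 x) = (homEquiv M₂ M x) ∘ₗ f := by
  obtain ⟨y, rfl⟩ := (homEquiv M₂ M).symm.surjective x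
  rw [LinearEquiv.apply_symm_apply, ← LinearEquiv.eq_symm_apply]
  exact Abelian.Ext.mk₀_comp_mk₀ (ModuleCat.ofHom f) (ModuleCat.ofHom y)

theorem extClass_comp_zero {S : ShortComplex (ModuleCat.{0} A)} (hS : S.ShortExact)
    {Y : ModuleCat.{0} A} {i : ℕ} (x : Abelian.Ext S.X₂ Y i) :
    hS.extClass.comp ((Abelian.Ext.mk₀ S.f).comp x (zero_add i)) (add_comm 1 i) = 0 := by
  rw [← Abelian.Ext.comp_assoc (h₁₂ := add_zero 1) (h₂₃ := zero_add i) (h := by omega)]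
  simp

theorem SES.δ'_pre {f : M₁ →ₗ[A] M₂} {g : M₂ →ₗ[A] M₃} (h : SES f g) (i : ℕ) (x : XT A M₂ M i) :
    h.δ' M i (pre M f i x) = 0 := by
  exact extClass_comp_zero h.se x

theorem xt_projective_subsingleton [Module.Projective A N] (i : ℕ) :
    Subsingleton (XT A N M (i + 1)) := by
  have : Projective (ModuleCat.of A N) := (IsProjective.iff_projective _).mp ‹_›
  exact ⟨fun x y => by
    rw [Abelian.Ext.eq_zero_of_projective x, Abelian.Ext.eq_zero_of_projective y]⟩

theorem SES.δh_exact {f : M₁ →ₗ[A] M₂} {g : M₂ →ₗ[A] M₃} (h : SES f g) :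
    Function.Exact (LinearMap.lcomp A M f) (h.δh M) := by
  intro x
  constructor
  · intro hx
    obtain ⟨y, hy⟩ := h.ex1' 0 _ hx
    refine ⟨homEquiv _ _ y, ?_⟩
    rw [LinearMap.lcomp_apply', ← homEquiv_pre, hy]; simp
  · rintro ⟨y, rfl⟩
    obtain ⟨y, rfl⟩ := (homEquiv M₂ M).surjective y
    rw [LinearMap.lcomp_apply', ← homEquiv_pre]
    simp [SES.δh, h.δ'_pre]

theorem SES.δh_surj {f : M₁ →ₗ[A] M₂} {g : M₂ →ₗ[A] M₃} (h : SES f g) [Module.Projective A M₂] :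
    Function.Surjective (h.δh M) := by
  intro x
  have := xt_projective_subsingleton (A := A) (N := M₂) (M := M) 0
  obtain ⟨y, hy⟩ := h.ex3' 0 x (Subsingleton.elim _ _)
  exact ⟨homEquiv _ _ y, by simp [SES.δh, hy]⟩

/-- dimension shift -/
theorem SES.shift {f : M₁ →ₗ[A] M₂} {g : M₂ →ₗ[A] M₃} (h : SES f g) [Module.Projective A M₂]
    (i : ℕ) : Nonempty (XT A M₁ M (i + 1) ≃ₗ[A] XT A M₃ M (i + 2)) := by
  refine ⟨LinearEquiv.ofBijective (h.δ' M (i + 1)) ⟨?_, ?_⟩⟩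
  · rw [injective_iff_map_eq_zero]
    intro x hx
    obtain ⟨y, rfl⟩ := h.ex1' _ x hx
    have := xt_projective_subsingleton (A := A) (N := M₂) (M := M) i
    rw [Subsingleton.elim y 0, map_zero]
  · intro x
    have := xt_projective_subsingleton (A := A) (N := M₂) (M := M) (i + 1)
    exact h.ex3' _ x (Subsingleton.elim _ _)

variable [Module.Flat A B] [IsNoetherianRing A]

def homBC (N M : Type) [AddCommGroup N] [Module A N] [AddCommGroup M] [Module A M]
    [Module.Finite A N] : B ⊗[A] (N →ₗ[A] M) ≃ₗ[B] (B ⊗[A] N →ₗ[B] B ⊗[A] M) :=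
  have : Module.FinitePresentation A N := Module.finitePresentation_of_finite A N
  (Module.FinitePresentation.isBaseChange_map (R := A) (M := N) (N := M) B).equiv

theorem homBC_tmul [Module.Finite A N] (b : B) (f : N →ₗ[A] M) :
    homBC B N M (b ⊗ₜ f) = b • f.baseChange B := by
  have : Module.FinitePresentation A N := Module.finitePresentation_of_finite A N
  exact (Module.FinitePresentation.isBaseChange_map (R := A) (M := N) (N := M) B).equiv_tmul b f

/-- flat base change for Ext -/
theorem xt_baseChange (M : Type) [AddCommGroup M] [Module A M] (i : ℕ) :
    ∀ (N : Type) [AddCommGroup N] [Module A N] [Module.Finite A N],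
      Nonempty (B ⊗[A] XT A N M i ≃ₗ[B] XT B (B ⊗[A] N) (B ⊗[A] M) i) := by
  induction i with
  | zero =>
    intro N _ _ _
    exact ⟨(homEquiv N M).baseChange A B _ _ ≪≫ₗ homBC B N M ≪≫ₗ (homEquiv _ _).symm⟩
  | succ i ih =>
    intro N _ _ _
    obtain ⟨n, g, hg⟩ := Module.Finite.exists_fin' A N
    have h := ses_ker g hg
    have hB := h.baseChange B
    cases i with
    | zero =>
      refine cokEquiv (A := B) (X' := (B ⊗[A] (Fin n → A)) →ₗ[B] B ⊗[A] M)
        (Y' := (B ⊗[A] (LinearMap.ker g)) →ₗ[B] B ⊗[A] M)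
        ((LinearMap.lcomp A M (LinearMap.ker g).subtype).baseChange B)
        ((h.δh M).baseChange B)
        (LinearMap.lcomp B (B ⊗[A] M) ((LinearMap.ker g).subtype.baseChange B)) (hB.δh (B ⊗[A] M)) (baseChange_exact B h.δh_exact h.δh_surj)
        hB.δh_exact (baseChange_surj B h.δh_surj) hB.δh_surj (homBC (A := A) B (Fin n → A) M)
        (homBC (A := A) B (LinearMap.ker g) M) ?_
      intro x
      induction x using TensorProduct.induction_on with
      | zero => simp
      | add x y hx hy => simp only [map_add, hx, hy]
      | tmul b f =>
        simp only [LinearMap.baseChange_tmul, homBC_tmul, map_smul]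
        congr 1
        rw [LinearMap.lcomp_apply', LinearMap.lcomp_apply', LinearMap.baseChange_comp]
    | succ j =>
      obtain ⟨e1⟩ := h.shift (M := M) j
      obtain ⟨e2⟩ := hB.shift (M := B ⊗[A] M) j
      obtain ⟨e3⟩ := ih (LinearMap.ker g)
      exact ⟨e1.symm.baseChange A B _ _ ≪≫ₗ e3 ≪≫ₗ e2⟩

end BaseChange

end CF

namespace CF

section ExtMore

variable [IsNoetherianRing A]
  {N N₁ N₂ M M₁ M₂ : Type} [AddCommGroup N] [Module A N] [AddCommGroup M] [Module A M]
  [AddCommGroup N₁] [Module A N₁] [AddCommGroup M₁] [Module A M₁]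
  [AddCommGroup N₂] [Module A N₂] [AddCommGroup M₂] [Module A M₂]

variable (A M₁ M₂) in
theorem ses_prod : SES (LinearMap.inl A M₁ M₂) (LinearMap.snd A M₁ M₂) :=
  ⟨LinearMap.inl_injective, LinearMap.snd_surjective, Function.Exact.inl_snd⟩

theorem EF.of_subsing_left [Subsingleton N] (i : ℕ) : EF A N M i :=
  EF.of_subsingleton ⟨fun x y => by
    have h : ∀ z : XT A N M i, z = 0 := fun z => by
      simpa using smul_xt_left (r := (1 : A)) (fun n => Subsingleton.elim _ _) i z
    rw [h x, h y]⟩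

theorem EF.of_subsing_right [Subsingleton M] (i : ℕ) : EF A N M i :=
  EF.of_subsingleton ⟨fun x y => by
    have h : ∀ z : XT A N M i, z = 0 := fun z => by
      simpa using smul_xt_right (r := (1 : A)) (fun n => Subsingleton.elim _ _) i z
    rw [h x, h y]⟩

theorem EF.pi_left {i : ℕ} (h : EF A N M i) (n : ℕ) : EF A (Fin n → N) M i := by
  induction n with
  | zero => exact EF.of_subsing_left i
  | succ n ih =>
    exact EF.congr_left (Fin.consLinearEquiv A (fun _ : Fin (n + 1) => N))
      ((ses_prod A N (Fin n → N)).EF2' h ih)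

theorem EF.pi_right {i : ℕ} (h : EF A N M i) (n : ℕ) : EF A N (Fin n → M) i := by
  induction n with
  | zero => exact EF.of_subsing_right i
  | succ n ih =>
    exact EF.congr_right (Fin.consLinearEquiv A (fun _ : Fin (n + 1) => M))
      ((ses_prod A M (Fin n → M)).EF2 h ih)

theorem EF.pi_right' {i : ℕ} (h : EF A N M i) (ι : Type) [Finite ι] : EF A N (ι → M) i := by
  obtain ⟨n, ⟨e⟩⟩ := Finite.exists_equiv_fin ι
  exact EF.congr_right (LinearEquiv.funCongrLeft A M e) (EF.pi_right h n)

theorem exists_quot_surj (a : Ideal A) (N : Type) [AddCommGroup N] [Module A N] [Module.Finite A N]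
    (hN : ∀ r ∈ a, ∀ x : N, r • x = 0) :
    ∃ (k : ℕ) (g : (Fin k → A ⧸ a) →ₗ[A] N), Function.Surjective g := by
  obtain ⟨k, g, hg⟩ := Module.Finite.exists_fin' A N
  refine ⟨k, LinearMap.lsum A (fun _ => A ⧸ a) A
    (fun i => Submodule.liftQ a (LinearMap.toSpanSingleton A N (g (Pi.single i 1))) ?_), ?_⟩
  · intro r hr
    rw [LinearMap.mem_ker, LinearMap.toSpanSingleton_apply]
    exact hN r hr _
  · intro y
    obtain ⟨c, rfl⟩ := hg y
    refine ⟨fun i => Ideal.Quotient.mk a (c i), ?_⟩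
    rw [LinearMap.lsum_apply, LinearMap.sum_apply]
    conv_rhs => rw [← LinearMap.sum_single_apply (fun _ : Fin k => A) c, map_sum]
    refine Finset.sum_congr rfl fun i _ => ?_
    change c i • g (Pi.single i 1) = _
    rw [← map_smul]
    congr 1
    ext j
    by_cases h : j = i
    · subst h; simp
    · simp [h]

/-- finiteness for all modules killed by `a` -/
theorem EF.of_quot {a : Ideal A} (n : ℕ) (h : ∀ i ≤ n, EF A (A ⧸ a) M i) :
    ∀ i ≤ n, ∀ (N : Type) [AddCommGroup N] [Module A N] [Module.Finite A N],
      (∀ r ∈ a, ∀ x : N, r • x = 0) → EF A N M i := by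
  intro i
  induction i with
  | zero =>
    intro hi N _ _ _ hN
    obtain ⟨k, g, hg⟩ := exists_quot_surj a N hN
    exact EF.sub' hg ((h 0 hi).pi_left k)
  | succ i ih =>
    intro hi N _ _ _ hN
    obtain ⟨k, g, hg⟩ := exists_quot_surj a N hN
    refine (ses_ker g hg).EF3' (ih (by omega) _ ?_) ((h _ hi).pi_left k)
    intro r hr x
    apply Subtype.ext
    funext j
    obtain ⟨y, hy⟩ := Ideal.Quotient.mk_surjective (x.1 j)
    change r • (x.1 j) = 0
    rw [← hy]
    change Ideal.Quotient.mk a (r • y) = 0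
    rw [Ideal.Quotient.eq_zero_iff_mem]
    exact a.mul_mem_right _ hr

theorem EF.of_primes {a : Ideal A} (h : ∀ p : Ideal A, p.IsPrime → a ≤ p → ∀ i, EF A (A ⧸ p) M i)
    (N : Type) [AddCommGroup N] [Module A N] [Module.Finite A N]
    (hN : ∀ r ∈ a, ∀ x : N, r • x = 0) : ∀ i, EF A N M i := by
  revert hN
  refine IsNoetherianRing.induction_on_isQuotientEquivQuotientPrime (A := A) (M := N) ‹_›
    (motive := fun N _ _ _ => (∀ r ∈ a, ∀ x : N, r • x = 0) → ∀ i, EF A N M i) ?_ ?_ ?_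
  · intro N _ _ _ _ _ i
    exact EF.of_subsing_left i
  · intro N _ _ _ p e hN i
    refine EF.congr_left e.symm (h p.1 p.2 ?_ i)
    intro r hr
    have := hN r hr (e.symm (Ideal.Quotient.mk _ 1))
    rw [← map_smul, LinearEquiv.map_eq_zero_iff] at this
    change Ideal.Quotient.mk p.1 (r • 1) = 0 at this
    rw [Ideal.Quotient.eq_zero_iff_mem] at this
    simpa using this
  · intro N₁ _ _ _ N₂ _ _ _ N₃ _ _ _ f g hf hg hfg h1 h3 h2 i
    refine SES.EF2' ⟨hf, hg, hfg⟩ (h1 ?_ i) (h3 ?_ i)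
    · intro r hr x
      apply hf
      rw [map_smul, h2 r hr, map_zero]
    · intro r hr x
      obtain ⟨y, rfl⟩ := hg x
      rw [← map_smul, h2 r hr, map_zero]

end ExtMore

end CF

namespace CF

section Koszul

variable {t : ℕ} (x : Fin t → A) (M : Type) [AddCommGroup M] [Module A M]

/-- extension by zero of a cochain -/
def kext {i : ℕ} (f : KoszulCochain x M i) (s : Finset (Fin t)) : M :=
  if h : s.card = i then f ⟨s, h⟩ else 0

/-- sign -/
def ksgn (s : Finset (Fin t)) (j : Fin t) : A := (-1) ^ ((s.filter (fun k => k < j)).card)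

theorem koszulD_apply (i : ℕ) (f : KoszulCochain x M i) (s : {s : Finset (Fin t) // s.card = i + 1}) :
    koszulD x M i f s = ∑ j ∈ s.1, (ksgn s.1 j * x j) • kext x M f (s.1.erase j) := by
  rw [koszulD, LinearMap.pi_apply, LinearMap.sum_apply,
    ← Finset.sum_attach s.1 (fun j => (ksgn s.1 j * x j) • kext x M f (s.1.erase j))]
  refine Finset.sum_congr rfl fun j _ => ?_
  have : (s.1.erase j.1).card = i := by simp [Finset.card_erase_of_mem j.2, s.2]
  rw [kext, dif_pos this]
  rfl

theorem ksgn_swap_lt (s : Finset (Fin t)) {j k : Fin t} (hj : j ∈ s) (hjk : j < k) :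
    (ksgn s k * ksgn (s.erase k) j : A) = - (ksgn s j * ksgn (s.erase j) k) := by
  have h1 : (s.erase k).filter (fun l => l < j) = s.filter (fun l => l < j) := by
    ext l
    simp only [Finset.mem_filter, Finset.mem_erase]
    constructor
    · rintro ⟨⟨_, h⟩, h'⟩; exact ⟨h, h'⟩
    · rintro ⟨h, h'⟩; exact ⟨⟨(h'.trans hjk).ne, h⟩, h'⟩
  have h2 : (s.filter (fun l => l < k)).card = ((s.erase j).filter (fun l => l < k)).card + 1 := by
    rw [Finset.filter_erase, Finset.card_erase_add_one]
    simp [hj, hjk]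
  unfold ksgn
  rw [h1, h2, pow_succ]
  ring

theorem ksgn_swap (s : Finset (Fin t)) {j k : Fin t} (hj : j ∈ s) (hk : k ∈ s) (hjk : j ≠ k) :
    (ksgn s k * ksgn (s.erase k) j : A) = - (ksgn s j * ksgn (s.erase j) k) := by
  rcases lt_or_gt_of_ne hjk with h | h
  · exact ksgn_swap_lt s hj h
  · rw [ksgn_swap_lt s hk h, neg_neg]

theorem koszulD_comp (i : ℕ) (f : KoszulCochain x M i) :
    koszulD x M (i + 1) (koszulD x M i f) = 0 := by
  funext s
  rw [koszulD_apply]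
  have h1 : ∀ j ∈ s.1, (ksgn s.1 j * x j) • kext x M (koszulD x M i f) (s.1.erase j) =
      ∑ k ∈ s.1.erase j, ((ksgn s.1 j * ksgn (s.1.erase j) k) * (x j * x k)) •
        kext x M f ((s.1.erase j).erase k) := by
    intro j hj
    have : (s.1.erase j).card = i + 1 := by simp [Finset.card_erase_of_mem hj, s.2]
    rw [kext, dif_pos this, koszulD_apply, Finset.smul_sum]
    refine Finset.sum_congr rfl fun k _ => ?_
    rw [smul_smul]
    congr 1; ring
  rw [Finset.sum_congr rfl h1, Finset.sum_sigma']
  refine Finset.sum_involution (fun p _ => ⟨p.2, p.1⟩) ?_ ?_ ?_ ?_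
  · rintro ⟨j, k⟩ hp
    simp only [Finset.mem_sigma, Finset.mem_erase] at hp
    dsimp only
    rw [ksgn_swap s.1 hp.1 hp.2.2 (Ne.symm hp.2.1), mul_comm (x k), Finset.erase_right_comm,
      neg_mul, neg_smul, add_neg_cancel]
  · rintro ⟨j, k⟩ hp _ h
    simp only [Finset.mem_sigma, Finset.mem_erase] at hp
    simp only [Sigma.mk.injEq] at h
    exact hp.2.1 h.1
  · rintro ⟨j, k⟩ hp
    simp only [Finset.mem_sigma, Finset.mem_erase] at hp ⊢
    exact ⟨hp.2.2, Ne.symm hp.2.1, hp.1⟩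
  · rintro ⟨j, k⟩ hp; rfl

theorem koszulBoundary_le (i : ℕ) : koszulBoundary x M i ≤ LinearMap.ker (koszulD x M i) := by
  cases i with
  | zero => exact bot_le
  | succ i =>
    rintro _ ⟨f, rfl⟩
    exact koszulD_comp x M i f

theorem koszulD_mem {a : Ideal A} (hx : ∀ j, x j ∈ a) (i : ℕ) :
    koszulD x M i ∈ a • (⊤ : Submodule A (KoszulCochain x M i →ₗ[A] KoszulCochain x M (i + 1))) := by
  classical
  have h : koszulD x M i = ∑ s : {s : Finset (Fin t) // s.card = i + 1}, ∑ j ∈ s.1.attach,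
      (((-1 : A) ^ ((s.1.filter (fun k => k < j.1)).card)) * x j.1) •
      ((LinearMap.single A (fun _ : {s : Finset (Fin t) // s.card = i + 1} => M) s) ∘ₗ
        (LinearMap.proj
        (⟨s.1.erase j.1, by simp [Finset.card_erase_of_mem j.2, s.2]⟩ :
          {s : Finset (Fin t) // s.card = i}) :
        KoszulCochain x M i →ₗ[A] M)) := by
    refine LinearMap.ext fun f => ?_
    rw [← LinearMap.sum_single_apply (fun _ => M) (koszulD x M i f), LinearMap.sum_apply]
    refine Finset.sum_congr rfl fun s _ => ?_
    rw [koszulD, LinearMap.pi_apply, LinearMap.sum_apply, LinearMap.sum_apply]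
    rw [← LinearMap.single_apply A, map_sum]
    refine Finset.sum_congr rfl fun j _ => ?_
    rw [LinearMap.smul_apply, map_smul]
    rfl
  rw [h]
  refine Submodule.sum_mem _ fun s _ => Submodule.sum_mem _ fun j _ => ?_
  exact Submodule.smul_mem_smul (a.mul_mem_left _ (hx _)) trivial

variable [IsNoetherianRing A] {N : Type} [AddCommGroup N] [Module A N]

theorem EF.koszul {n : ℕ} (h : EF A N M n) (i : ℕ) : EF A N (KoszulCochain x M i) n :=
  EF.pi_right' h _

theorem EF.koszul_range {i : ℕ} (h : EF A N M 0) : EF A N (LinearMap.range (koszulD x M i)) 0 :=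
  EF.sub (Submodule.injective_subtype _) (EF.koszul x M h (i + 1))

theorem EF.koszul_quot {i n : ℕ} (h : EF A N (KoszulCohomology x M i) n)
    (h' : EF A N (LinearMap.range (koszulD x M i)) n) :
    EF A N (KoszulCochain x M i ⧸ koszulBoundary x M i) n := by
  let f : KoszulCohomology x M i →ₗ[A] KoszulCochain x M i ⧸ koszulBoundary x M i :=
    Submodule.mapQ _ _ (LinearMap.ker (koszulD x M i)).subtype le_rfl
  let g : (KoszulCochain x M i ⧸ koszulBoundary x M i) →ₗ[A] LinearMap.range (koszulD x M i) :=
    Submodule.liftQ _ (koszulD x M i).rangeRestrict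
      (by rw [LinearMap.ker_rangeRestrict]; exact koszulBoundary_le x M i)
  have hs : SES f g := by
    refine ⟨?_, ?_, ?_⟩
    · rw [injective_iff_map_eq_zero]
      intro z hz
      obtain ⟨z, rfl⟩ := Submodule.mkQ_surjective _ z
      rw [Submodule.mkQ_apply, Submodule.mapQ_apply, Submodule.Quotient.mk_eq_zero] at hz
      exact (Submodule.Quotient.mk_eq_zero _).2 hz
    · rintro ⟨_, y, rfl⟩
      exact ⟨Submodule.Quotient.mk y, rfl⟩
    · intro z
      obtain ⟨z, rfl⟩ := Submodule.mkQ_surjective _ z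
      constructor
      · intro hz
        have : koszulD x M i z = 0 := congrArg Subtype.val hz
        exact ⟨Submodule.Quotient.mk ⟨z, this⟩, rfl⟩
      · rintro ⟨w, hw⟩
        obtain ⟨w, rfl⟩ := Submodule.mkQ_surjective _ w
        rw [← hw]
        exact Subtype.ext w.2
  exact hs.EF2 h h'

theorem koszul_step {a : Ideal A} (hx : ∀ j, x j ∈ a) (ha : ∀ r ∈ a, ∀ n : N, r • n = 0)
    (H : ∀ i ≤ 2, ∀ j ≤ 2, EF A N (KoszulCohomology x M j) i) : ∀ i ≤ 2, EF A N M i := by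
  have hK : ∀ i ≤ 2, EF A N (LinearMap.ker (koszulD x M 0)) i := by
    intro i hi
    refine EF.congr_right (Submodule.quotEquivOfEqBot _ ?_) (H i hi 0 (by omega))
    change Submodule.comap _ ⊥ = ⊥
    rw [Submodule.comap_bot, Submodule.ker_subtype]
  have hM : ∀ i, EF A N (KoszulCochain x M 0) i → EF A N M i := by
    intro i h
    have : Unique {s : Finset (Fin t) // s.card = 0} :=
      { default := ⟨∅, rfl⟩
        uniq := fun s => Subtype.ext (Finset.card_eq_zero.1 s.2) }
    exact EF.congr_right (LinearEquiv.funUnique _ A M) h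
  have hz : ∀ i, post N (koszulD x M 0) i = 0 := fun i =>
    post_eq_zero_of_mem ha _ (koszulD_mem x M hx 0) i
  have h0 : EF A N M 0 := hM 0 (EF.of_post_zero _ 0 (hz 0) (hK 0 (by omega)) (by omega))
  have h1 : EF A N M 1 := by
    refine hM 1 (EF.of_post_zero _ 1 (hz 1) (hK 1 (by omega)) ?_)
    intro j hj
    obtain rfl : j = 0 := by omega
    exact EF.koszul_quot x M (i := 1) (H 0 (by omega) 1 (by omega)) (EF.koszul_range x M h0)
  have h2 : EF A N M 2 := by
    refine hM 2 (EF.of_post_zero _ 2 (hz 2) (hK 2 (by omega)) ?_)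
    intro j hj
    obtain rfl : j = 1 := by omega
    refine EF.koszul_quot x M (i := 1) (H 1 (by omega) 1 (by omega)) ?_
    refine (ses_sub (LinearMap.range (koszulD x M 1))).EF1 ?_ (EF.koszul x M h1 2)
    exact EF.koszul_quot x M (i := 2) (H 0 (by omega) 2 (by omega)) (EF.koszul_range x M h0)
  intro i hi
  interval_cases i <;> assumption

end Koszul

end CF

namespace CF

section Artin

variable {M M₁ M₂ P : Type} [AddCommGroup M] [Module A M] [AddCommGroup P] [Module A P]
  [AddCommGroup M₁] [Module A M₁] [AddCommGroup M₂] [Module A M₂]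

/-- every element is killed by a power of `a` -/
def Tor (a : Ideal A) (M : Type) [AddCommGroup M] [Module A M] : Prop :=
  ∀ m : M, ∃ k : ℕ, ∀ r ∈ a ^ k, r • m = 0

theorem Tor.of_inj {a : Ideal A} (f : M₁ →ₗ[A] M₂) (hf : Function.Injective f) (h : Tor a M₂) :
    Tor a M₁ := by
  intro m
  obtain ⟨k, hk⟩ := h (f m)
  exact ⟨k, fun r hr => hf (by rw [map_smul, hk r hr, map_zero])⟩

theorem Tor.of_surj {a : Ideal A} (f : M₁ →ₗ[A] M₂) (hf : Function.Surjective f) (h : Tor a M₁) :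
    Tor a M₂ := by
  intro m
  obtain ⟨m, rfl⟩ := hf m
  obtain ⟨k, hk⟩ := h m
  exact ⟨k, fun r hr => by rw [← map_smul, hk r hr, map_zero]⟩

theorem Tor.mono {a b : Ideal A} (hab : a ≤ b) (h : Tor b M) : Tor a M := by
  intro m
  obtain ⟨k, hk⟩ := h m
  exact ⟨k, fun r hr => hk r (Ideal.pow_right_mono hab k hr)⟩

/-- leading submodules -/
def lead (x : A) (N : Submodule A M) (n : ℕ) : Submodule A M :=
  (N ⊓ LinearMap.ker (LinearMap.lsmul A M (x ^ (n + 1)))).map (LinearMap.lsmul A M (x ^ n))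

theorem mem_lead {x : A} {N : Submodule A M} {n : ℕ} {v : M} :
    v ∈ lead x N n ↔ ∃ w ∈ N, x ^ (n + 1) • w = 0 ∧ x ^ n • w = v := by
  simp only [lead, Submodule.mem_map, Submodule.mem_inf, LinearMap.mem_ker, LinearMap.lsmul_apply]
  constructor
  · rintro ⟨w, ⟨h1, h2⟩, h3⟩; exact ⟨w, h1, h2, h3⟩
  · rintro ⟨w, h1, h2, h3⟩; exact ⟨w, ⟨h1, h2⟩, h3⟩

theorem lead_anti {x : A} {N N' : Submodule A M} {n n' : ℕ} (hN : N ≤ N') (hn : n' ≤ n) :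
    lead x N n ≤ lead x N' n' := by
  intro v hv
  obtain ⟨w, h1, h2, h3⟩ := mem_lead.1 hv
  refine mem_lead.2 ⟨x ^ (n - n') • w, hN (N.smul_mem _ h1), ?_, ?_⟩
  · rw [smul_smul, ← pow_add, ← h2]; congr 2; omega
  · rw [smul_smul, ← pow_add, ← h3]; congr 2; omega

theorem lead_le {x : A} {N : Submodule A M} {n : ℕ} :
    lead x N n ≤ LinearMap.ker (LinearMap.lsmul A M x) := by
  intro v hv
  obtain ⟨w, h1, h2, h3⟩ := mem_lead.1 hv
  rw [LinearMap.mem_ker, LinearMap.lsmul_apply, ← h3, smul_smul, ← pow_succ', h2]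

theorem le_of_lead {x : A} {N N' : Submodule A M} (h : N' ≤ N) (hx : ∀ m : M, ∃ k : ℕ, x ^ k • m = 0)
    (hl : ∀ n, lead x N n ≤ lead x N' n) : N ≤ N' := by
  have key : ∀ k : ℕ, ∀ v ∈ N, x ^ k • v = 0 → v ∈ N' := by
    intro k
    induction k with
    | zero => intro v _ hv; rw [pow_zero, one_smul] at hv; rw [hv]; exact N'.zero_mem
    | succ k ih =>
      intro v hv h0
      obtain ⟨w, h1, h2, h3⟩ := mem_lead.1 (hl k (mem_lead.2 ⟨v, hv, h0, rfl⟩))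
      have := ih (v - w) (N.sub_mem hv (h h1)) (by rw [smul_sub, h3, sub_self])
      simpa using N'.add_mem this h1
  intro v hv
  obtain ⟨k, hk⟩ := hx v
  exact key k v hv hk

theorem artinian_of_ker {x : A} (hx : ∀ m : M, ∃ k : ℕ, x ^ k • m = 0)
    (h : IsArtinian A (LinearMap.ker (LinearMap.lsmul A M x))) : IsArtinian A M := by
  rw [← monotone_stabilizes_iff_artinian]
  intro f
  let K := LinearMap.ker (LinearMap.lsmul A M x)
  let g : ℕ → ℕ → Submodule A M := fun m n => lead x (OrderDual.ofDual (f m)) n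
  have hg : ∀ {m m' n n'}, m ≤ m' → n ≤ n' → g m' n' ≤ g m n := fun h1 h2 =>
    lead_anti (f.monotone h1) h2
  -- stabilization of sequences in K
  have stab : ∀ s : ℕ → Submodule A M, Antitone s → (∀ i, s i ≤ K) → ∃ n, ∀ m, n ≤ m → s n = s m := by
    intro s hs hK
    let s' : ℕ →o (Submodule A K)ᵒᵈ :=
      ⟨fun i => OrderDual.toDual ((s i).comap K.subtype), fun i j hij =>
        Submodule.comap_mono (hs hij)⟩
    obtain ⟨n, hn⟩ := monotone_stabilizes_iff_artinian.2 h s'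
    refine ⟨n, fun m hm => ?_⟩
    have : (s n).comap K.subtype = (s m).comap K.subtype := hn m hm
    have h2 := congrArg (Submodule.map K.subtype) this
    rwa [Submodule.map_comap_subtype, Submodule.map_comap_subtype, inf_eq_right.2 (hK _),
      inf_eq_right.2 (hK _)] at h2
  obtain ⟨d, hd⟩ := stab (fun i => g i i) (fun i j hij => hg hij hij) (fun i => lead_le)
  have hcol : ∀ n, ∃ c, ∀ m, c ≤ m → g c n = g m n := fun n =>
    stab (fun i => g i n) (fun i j hij => hg hij le_rfl) (fun i => lead_le)
  choose c hc using hcol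
  let D := d + ∑ n ∈ Finset.range d, c n
  refine ⟨D, fun m hm => ?_⟩
  have hle : OrderDual.ofDual (f m) ≤ OrderDual.ofDual (f D) := f.monotone hm
  refine (le_antisymm hle (le_of_lead hle hx ?_)).symm
  intro n
  change g D n ≤ g m n
  by_cases hn : n < d
  · have h1 : c n ≤ D := le_trans (Finset.single_le_sum (f := c) (fun _ _ => Nat.zero_le _)
      (Finset.mem_range.2 hn)) (Nat.le_add_left _ _)
    rw [← hc n D h1, ← hc n m (h1.trans hm)]
  · push Not at hn
    have h1 : g D n ≤ g d d := hg (Nat.le_add_right _ _) hn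
    have h2 : g (m + n) (m + n) ≤ g m n := hg (Nat.le_add_right _ _) (Nat.le_add_left _ _)
    refine h1.trans (le_trans (le_of_eq (hd (m + n) ?_)) h2)
    omega

theorem artinian_of_torsionBy_finset (s : Finset A) :
    ∀ (M : Type) [AddCommGroup M] [Module A M], (∀ x ∈ s, ∀ m : M, ∃ k : ℕ, x ^ k • m = 0) →
    IsArtinian A (Submodule.torsionBySet A M (s : Set A)) → IsArtinian A M := by
  classical
  induction s using Finset.induction_on with
  | empty =>
    intro M _ _ _ h
    exact isArtinian_of_surjective _ (Submodule.subtype _) (fun m => ⟨⟨m, by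
      rw [Submodule.mem_torsionBySet_iff]; rintro ⟨y, hy⟩; exact absurd hy (Finset.notMem_empty y)⟩, rfl⟩)
  | insert x s hxs ih =>
    intro M _ _ hs h
    refine artinian_of_ker (hs x (Finset.mem_insert_self _ _)) (ih _ ?_ ?_)
    · intro y hy m
      obtain ⟨k, hk⟩ := hs y (Finset.mem_insert_of_mem hy) m
      exact ⟨k, Subtype.ext hk⟩
    · let f : Submodule.torsionBySet A (LinearMap.ker (LinearMap.lsmul A M x)) (s : Set A) →ₗ[A]
          Submodule.torsionBySet A M ((insert x s : Finset A) : Set A) :=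
        LinearMap.codRestrict _ ((Submodule.subtype _) ∘ₗ (Submodule.subtype _)) (by
          rintro ⟨⟨m, hm⟩, hm'⟩
          rw [Submodule.mem_torsionBySet_iff]
          rintro ⟨y, hy⟩
          rw [Finset.coe_insert, Set.mem_insert_iff] at hy
          rcases hy with rfl | hy
          · exact hm
          · rw [Submodule.mem_torsionBySet_iff] at hm'
            exact congrArg Subtype.val (hm' ⟨y, hy⟩))
      refine isArtinian_of_injective f ?_
      rintro ⟨⟨m, hm⟩, hm'⟩ ⟨⟨n, hn⟩, hn'⟩ h
      have : m = n := congrArg Subtype.val h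
      subst this; rfl

variable [IsNoetherianRing A]

theorem artinian_of_torsion {a : Ideal A} (hM : Tor a M)
    (h : IsArtinian A (Submodule.torsionBySet A M (a : Set A))) : IsArtinian A M := by
  obtain ⟨s, rfl⟩ := IsNoetherian.noetherian a
  refine artinian_of_torsionBy_finset s M ?_ ?_
  · intro x hx m
    obtain ⟨k, hk⟩ := hM m
    exact ⟨k, hk _ (Ideal.pow_mem_pow (Submodule.subset_span hx) k)⟩
  · change IsArtinian A (Submodule.torsionBySet A M (Ideal.span (s : Set A) : Set A)) at h
    rw [Submodule.torsionBySet_eq_torsionBySet_span]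
    exact h

/-- `Hom(A/a, M) ≃ (0 :_M a)` -/
theorem EF_zero_iff {a : Ideal A} :
    EF A (A ⧸ a) M 0 ↔ Module.Finite A (Submodule.torsionBySet A M (a : Set A)) := by
  rw [EF.zero_iff]
  let ev : ((A ⧸ a) →ₗ[A] M) →ₗ[A] M := LinearMap.applyₗ (R := A) (1 : A ⧸ a)
  have hev : ∀ f, ev f = f 1 := fun _ => rfl
  let e : ((A ⧸ a) →ₗ[A] M) →ₗ[A] Submodule.torsionBySet A M (a : Set A) :=
    LinearMap.codRestrict _ ev (by
      intro f
      rw [Submodule.mem_torsionBySet_iff]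
      rintro ⟨r, hr⟩
      rw [hev, ← map_smul]
      have : r • (1 : A ⧸ a) = 0 := by
        rw [Algebra.smul_def, mul_one]; exact Ideal.Quotient.eq_zero_iff_mem.2 hr
      simp [this])
  have he : ∀ f, ((e f : _) : M) = f 1 := fun _ => rfl
  have hb : Function.Bijective e := by
    constructor
    · intro f g h
      have h1 : f 1 = g 1 := by rw [← he, ← he, h]
      refine LinearMap.ext fun z => ?_
      obtain ⟨z, rfl⟩ := Ideal.Quotient.mk_surjective z
      have : Ideal.Quotient.mk a z = z • (1 : A ⧸ a) := by rw [Algebra.smul_def, mul_one]; rfl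
      rw [this, map_smul, map_smul, h1]
    · rintro ⟨m, hm⟩
      rw [Submodule.mem_torsionBySet_iff] at hm
      refine ⟨Submodule.liftQ a (LinearMap.toSpanSingleton A M m) ?_, Subtype.ext ?_⟩
      · intro r hr; rw [LinearMap.mem_ker, LinearMap.toSpanSingleton_apply]; exact hm ⟨r, hr⟩
      · rw [he]
        exact (Submodule.liftQ_apply a (LinearMap.toSpanSingleton A M m) 1).trans (by simp)
  exact ⟨fun h => Module.Finite.equiv (LinearEquiv.ofBijective e hb),
    fun h => Module.Finite.equiv (LinearEquiv.ofBijective e hb).symm⟩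

theorem finite_torsion_pow {a : Ideal A}
    (h : Module.Finite A (Submodule.torsionBySet A M (a : Set A))) (k : ℕ) :
    Module.Finite A (Submodule.torsionBySet A M ((a ^ k : Ideal A) : Set A)) := by
  induction k with
  | zero =>
    have : Subsingleton (Submodule.torsionBySet A M ((a ^ 0 : Ideal A) : Set A)) := by
      refine ⟨fun x y => ?_⟩
      have key : ∀ z : Submodule.torsionBySet A M ((a ^ 0 : Ideal A) : Set A), z = 0 := by
        rintro ⟨z, hz⟩
        rw [Submodule.mem_torsionBySet_iff] at hz
        have := hz ⟨1, by simp⟩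
        exact Subtype.ext (by simpa using this)
      rw [key x, key y]
    infer_instance
  | succ k ih =>
    obtain ⟨s, hs⟩ := IsNoetherian.noetherian a
    let g : Submodule.torsionBySet A M ((a ^ (k + 1) : Ideal A) : Set A) →ₗ[A]
        (s → Submodule.torsionBySet A M ((a ^ k : Ideal A) : Set A)) :=
      LinearMap.pi fun x => LinearMap.codRestrict _
        ((LinearMap.lsmul A M x.1) ∘ₗ Submodule.subtype _) (by
          rintro ⟨m, hm⟩
          rw [Submodule.mem_torsionBySet_iff] at hm ⊢
          rintro ⟨r, hr⟩
          have hx : x.1 ∈ a := by rw [← hs]; exact Submodule.subset_span x.2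
          have := hm ⟨r * x.1, by rw [pow_succ]; exact Ideal.mul_mem_mul hr hx⟩
          rw [mul_smul] at this
          exact this)
    have hle : Submodule.torsionBySet A M (a : Set A) ≤
        Submodule.torsionBySet A M ((a ^ (k + 1) : Ideal A) : Set A) :=
      Submodule.torsionBySet_le_torsionBySet_of_subset (Ideal.pow_le_self (by omega))
    refine finite_of_ker (Submodule.inclusion hle) g h ?_ Module.Finite.pi
    rintro ⟨m, hm⟩ hg
    refine ⟨⟨m, ?_⟩, rfl⟩
    rw [← hs]
    change m ∈ Submodule.torsionBySet A M (Ideal.span (s : Set A) : Set A)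
    rw [← Submodule.torsionBySet_eq_torsionBySet_span, Submodule.mem_torsionBySet_iff]
    rintro ⟨x, hx⟩
    exact congrArg Subtype.val (congrFun hg ⟨x, hx⟩)

/-- artinian modules with f.g. `(0 : a)` have all Ext f.g. -/
theorem P0 {a : Ideal A} [hP : IsArtinian A P] (h : EF A (A ⧸ a) P 0) :
    ∀ i, EF A (A ⧸ a) P i := by
  have key : ∀ K : Submodule A P, ∀ i, EF A (A ⧸ a) K i := by
    intro K
    induction K using WellFoundedLT.induction with
    | _ K ih =>
    have h0 : EF A (A ⧸ a) K 0 := EF.sub K.injective_subtype h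
    -- every proper submodule of K is good
    have ih' : ∀ L : Submodule A K, L ≠ ⊤ → ∀ i, EF A (A ⧸ a) L i := by
      intro L hL i
      have hlt : L.map K.subtype < K := by
        refine lt_of_le_of_ne (Submodule.map_subtype_le _ _) fun h => hL ?_
        rw [eq_top_iff]; intro x _
        have : (x : P) ∈ L.map K.subtype := by rw [h]; exact x.2
        obtain ⟨y, hy, hyx⟩ := this
        rwa [← Subtype.ext hyx]
      exact EF.congr_right (Submodule.equivSubtypeMap K L).symm (ih _ hlt i)
    by_cases hall : ∀ y ∈ a, ∀ v : K, y • v = 0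
    · have : Module.Finite A K := by
        rw [EF_zero_iff] at h0
        refine Module.Finite.of_surjective (Submodule.subtype _) (fun v => ⟨⟨v, ?_⟩, rfl⟩)
          (M := Submodule.torsionBySet A K (a : Set A))
        rw [Submodule.mem_torsionBySet_iff]
        exact fun r => hall r.1 r.2 v
      exact fun i => EF.of_finite i
    · push Not at hall
      obtain ⟨y, hy, v, hv⟩ := hall
      let f : K →ₗ[A] K := LinearMap.lsmul A K y
      have hker : LinearMap.ker f ≠ ⊤ := fun h => hv (by
        have : v ∈ LinearMap.ker f := by rw [h]; trivial
        exact this)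
      by_cases hr : LinearMap.range f = ⊤
      · intro i
        refine EF.of_post_zero f i ?_ (ih' _ hker i) ?_
        · refine post_eq_zero_of_mem (a := a) ?_ f ?_ i
          · intro r hr n
            obtain ⟨n, rfl⟩ := Ideal.Quotient.mk_surjective n
            rw [Algebra.smul_def]
            exact Ideal.Quotient.eq_zero_iff_mem.2 (a.mul_mem_right _ hr)
          · have : f = y • LinearMap.id := by ext; rfl
            rw [this]; exact Submodule.smul_mem_smul hy trivial
        · intro j _
          have : Subsingleton (K ⧸ LinearMap.range f) := 
            (Submodule.unique_quotient_iff_eq_top.2 hr).some.instSubsingleton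
          exact EF.of_subsing_right j
      · intro i
        exact (ses_ker f.rangeRestrict f.surjective_rangeRestrict).EF2
          (by rw [LinearMap.ker_rangeRestrict]; exact ih' _ hker i) (ih' _ hr i)
  intro i
  exact EF.congr_right Submodule.topEquiv (key ⊤ i)

/-- good elements for artinian modules -/
theorem exists_good {a : Ideal A} [hP : IsArtinian A P]
    (h : Module.Finite A (Submodule.torsionBySet A P (a : Set A))) :
    ∃ F : Finset (Ideal A), (∀ p ∈ F, p.IsPrime ∧ ¬ a ≤ p) ∧ ∀ y ∈ a, (∀ p ∈ F, y ∉ p) →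
      Module.Finite A (P ⧸ LinearMap.range (LinearMap.lsmul A P y)) := by
  classical
  -- reformulate : exists f.g. submodule G with K ≤ G + yK
  have key : ∀ K : Submodule A P, ∃ F : Finset (Ideal A), (∀ p ∈ F, p.IsPrime ∧ ¬ a ≤ p) ∧
      ∀ y ∈ a, (∀ p ∈ F, y ∉ p) → ∃ G : Submodule A P, G.FG ∧
        K ≤ G ⊔ K.map (LinearMap.lsmul A P y) := by
    intro K
    induction K using WellFoundedLT.induction with
    | _ K ih =>
    by_cases hsum : ∃ K₁ K₂, K₁ < K ∧ K₂ < K ∧ K₁ ⊔ K₂ = K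
    · obtain ⟨K₁, K₂, h1, h2, h12⟩ := hsum
      obtain ⟨F₁, hF₁, hG₁⟩ := ih K₁ h1
      obtain ⟨F₂, hF₂, hG₂⟩ := ih K₂ h2
      refine ⟨F₁ ∪ F₂, ?_, ?_⟩
      · intro p hp
        rcases Finset.mem_union.1 hp with hp | hp
        · exact hF₁ p hp
        · exact hF₂ p hp
      · intro y hy hyF
        obtain ⟨G₁, hG1, hK1⟩ := hG₁ y hy fun p hp => hyF p (Finset.mem_union_left _ hp)
        obtain ⟨G₂, hG2, hK2⟩ := hG₂ y hy fun p hp => hyF p (Finset.mem_union_right _ hp)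
        refine ⟨G₁ ⊔ G₂, hG1.sup hG2, ?_⟩
        conv_lhs => rw [← h12]
        refine sup_le (hK1.trans (sup_le_sup le_sup_left (Submodule.map_mono h1.le)))
          (hK2.trans (sup_le_sup le_sup_right (Submodule.map_mono h2.le)))
    · have hirr : ∀ K₁ K₂, K₁ ≤ K → K₂ ≤ K → K₁ ⊔ K₂ = K → K₁ = K ∨ K₂ = K := by
        intro K₁ K₂ h1 h2 h12
        by_contra hcon
        push Not at hcon
        exact hsum ⟨K₁, K₂, lt_of_le_of_ne h1 hcon.1, lt_of_le_of_ne h2 hcon.2, h12⟩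
      have hmapK : ∀ y : A, K.map (LinearMap.lsmul A P y) ≤ K := by
        rintro y _ ⟨v, hv, rfl⟩; exact K.smul_mem y hv
      by_cases hK0 : K = ⊥
      · exact ⟨∅, by simp, fun y _ _ => ⟨⊥, Submodule.fg_bot, by rw [hK0]; exact bot_le⟩⟩
      let p : Ideal A :=
        { carrier := {y | K.map (LinearMap.lsmul A P y) ≠ K}
          zero_mem' := by
            intro h; apply hK0
            rw [map_zero, Submodule.map_zero] at h; exact h.symm
          add_mem' := by
            intro y z hy hz h
            have h3 : K ≤ K.map (LinearMap.lsmul A P y) ⊔ K.map (LinearMap.lsmul A P z) := by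
              conv_lhs => rw [← h]
              rintro _ ⟨v, hv, rfl⟩
              rw [map_add, LinearMap.add_apply]
              exact Submodule.add_mem_sup ⟨v, hv, rfl⟩ ⟨v, hv, rfl⟩
            rcases hirr _ _ (hmapK y) (hmapK z) (le_antisymm (sup_le (hmapK y) (hmapK z)) h3) with h | h
            · exact hy h
            · exact hz h
          smul_mem' := by
            intro c y hy h
            apply hy
            refine le_antisymm (hmapK y) ?_
            conv_lhs => rw [← h]
            rintro _ ⟨v, hv, rfl⟩
            refine ⟨c • v, K.smul_mem c hv, ?_⟩
            simp [smul_smul, mul_comm] }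
      have hmem : ∀ y, y ∈ p ↔ K.map (LinearMap.lsmul A P y) ≠ K := fun _ => Iff.rfl
      have hp : p.IsPrime := by
        refine ⟨?_, ?_⟩
        · rw [Ideal.ne_top_iff_one, hmem, not_not]
          have : (LinearMap.lsmul A P 1) = LinearMap.id := by ext; simp
          rw [this, Submodule.map_id]
        · intro y z hyz
          by_contra hcon
          push Not at hcon
          rw [hmem, hmem, not_not, not_not] at hcon
          apply hyz
          have : (LinearMap.lsmul A P (y * z)) = (LinearMap.lsmul A P y) ∘ₗ LinearMap.lsmul A P z := by
            ext v; exact mul_smul y z v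
          rw [this, Submodule.map_comp, hcon.2, hcon.1]
      by_cases hap : a ≤ p
      · refine ⟨∅, by simp, fun y _ _ => ⟨K, ?_, le_sup_left⟩⟩
        -- every element of a is nilpotent on K
        have hnil : ∀ y ∈ a, ∃ n : ℕ, ∀ v ∈ K, y ^ n • v = 0 := by
          intro y hy
          obtain ⟨n, hn⟩ := (LinearMap.eventually_codisjoint_ker_pow_range_pow
            (LinearMap.lsmul A K y : Module.End A K)).exists_forall_of_atTop
          have hn := hn (n + 1) (by omega)
          have hpow : ∀ k : ℕ, ((LinearMap.lsmul A K y : Module.End A K) ^ k) = LinearMap.lsmul A K (y ^ k) := by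
            intro k
            induction k with
            | zero => ext; simp
            | succ k ih => rw [pow_succ, ih]; ext v; exact congrArg Subtype.val (show y ^ k • (y • v) = y ^ (k+1) • v by rw [smul_smul, pow_succ])
          rw [hpow] at hn
          have h3 := congrArg (Submodule.map K.subtype) (codisjoint_iff.1 hn)
          rw [Submodule.map_sup, Submodule.map_top, Submodule.range_subtype] at h3
          rcases hirr _ _ (Submodule.map_subtype_le _ _) (Submodule.map_subtype_le _ _) h3 with h4 | h4
          · refine ⟨n + 1, fun v hv => ?_⟩
            rw [← h4] at hv
            obtain ⟨w, hw, rfl⟩ := hv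
            exact congrArg Subtype.val (LinearMap.mem_ker.1 hw)
          · exfalso
            refine (hmem y).1 (hap hy) (le_antisymm (hmapK y) ?_)
            conv_lhs => rw [← h4]
            rintro _ ⟨_, ⟨w, rfl⟩, rfl⟩
            refine ⟨y ^ n • w, K.smul_mem _ w.2, ?_⟩
            change y • (y ^ n • (w : P)) = y ^ (n + 1) • (w : P)
            rw [smul_smul, pow_succ']
        have hrad : a ≤ (Module.annihilator A K).radical := by
          intro y hy
          obtain ⟨n, hn⟩ := hnil y hy
          refine ⟨n, Module.mem_annihilator.2 fun v => Subtype.ext (hn v v.2)⟩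
        obtain ⟨k, hk⟩ := Ideal.exists_pow_le_of_le_radical_of_fg hrad (IsNoetherian.noetherian a)
        have hfin := finite_torsion_pow h k
        have hle : K ≤ Submodule.torsionBySet A P ((a ^ k : Ideal A) : Set A) := by
          intro v hv
          rw [Submodule.mem_torsionBySet_iff]
          rintro ⟨r, hr⟩
          exact congrArg Subtype.val (Module.mem_annihilator.1 (hk hr) ⟨v, hv⟩)
        have : Module.Finite A K :=
          Module.Finite.of_injective (Submodule.inclusion hle) (Submodule.inclusion_injective hle)
        exact Module.Finite.iff_fg.1 this
      · refine ⟨{p}, by simpa using ⟨hp, hap⟩, fun y _ hy => ⟨⊥, Submodule.fg_bot, ?_⟩⟩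
        have := hy p (Finset.mem_singleton_self p)
        rw [hmem, not_not] at this
        rw [this]; exact le_sup_right
  obtain ⟨F, hF, hG⟩ := key ⊤
  refine ⟨F, hF, fun y hy hyF => ?_⟩
  obtain ⟨G, hG, hle⟩ := hG y hy hyF
  have : Module.Finite A G := Module.Finite.iff_fg.2 hG
  refine Module.Finite.of_surjective
    ((LinearMap.range (LinearMap.lsmul A P y)).mkQ ∘ₗ G.subtype) ?_
  intro z
  obtain ⟨z, rfl⟩ := Submodule.mkQ_surjective _ z
  obtain ⟨g, hg, w, ⟨u, _, rfl⟩, rfl⟩ := Submodule.mem_sup.1 (hle (Submodule.mem_top (x := z)))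
  refine ⟨⟨g, hg⟩, ?_⟩
  rw [map_add, LinearMap.comp_apply]
  have : (LinearMap.range (LinearMap.lsmul A P y)).mkQ (LinearMap.lsmul A P y u) = 0 :=
    (Submodule.Quotient.mk_eq_zero _).2 ⟨u, rfl⟩
  rw [this, add_zero]; rfl

/-- f.g. modules killed by an ideal all of whose primes are maximal are artinian -/
theorem artinian_of_killed {c : Ideal A} (hc : ∀ p : Ideal A, p.IsPrime → c ≤ p → p.IsMaximal)
    [Module.Finite A M] (hM : ∀ r ∈ c, ∀ m : M, r • m = 0) : IsArtinian A M := by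
  have h1 : IsArtinianRing (A ⧸ c) := by
    rw [isArtinianRing_iff_krullDimLE_zero, Ring.krullDimLE_zero_iff]
    intro p hp
    have h2 := hc (p.comap (Ideal.Quotient.mk c)) inferInstance (by
      intro r hr; rw [Ideal.mem_comap, Ideal.Quotient.eq_zero_iff_mem.2 hr]; exact p.zero_mem)
    have := Ideal.map_eq_top_or_isMaximal_of_surjective _ (Ideal.Quotient.mk_surjective (I := c)) h2
    rw [Ideal.map_comap_of_surjective _ Ideal.Quotient.mk_surjective] at this
    exact this.resolve_left hp.ne_top
  obtain ⟨k, g, hg⟩ := exists_quot_surj c M hM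
  have h2 : IsArtinian A (A ⧸ c) :=
    isArtinian_of_surjective_algebraMap (R := A ⧸ c) Ideal.Quotient.mk_surjective
  exact isArtinian_of_surjective _ g hg

end Artin
end CF

namespace CF

section P1

/-- complement of the minimal primes over `b` -/
def Smin (b : Ideal A) : Submonoid A where
  carrier := {s | ∀ q ∈ b.minimalPrimes, s ∉ q}
  one_mem' := fun q hq h => hq.1.1.ne_top (q.eq_top_iff_one.2 h)
  mul_mem' := fun {s t} hs ht q hq h => (hq.1.1.mem_or_mem h).elim (hs q hq) (ht q hq)

theorem mem_Smin {b : Ideal A} {s : A} : s ∈ Smin b ↔ ∀ q ∈ b.minimalPrimes, s ∉ q := Iff.rfl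

theorem exists_common (S : Submonoid A) (t : Finset A) (R : A → A → Prop)
    (hmul : ∀ s u x, R s x → R (u * s) x) (h : ∀ x ∈ t, ∃ s ∈ S, R s x) :
    ∃ s ∈ S, ∀ x ∈ t, R s x := by
  classical
  induction t using Finset.induction_on with
  | empty => exact ⟨1, S.one_mem, by simp⟩
  | insert x t hx ih =>
    obtain ⟨s, hs, hst⟩ := ih fun x hx => h x (Finset.mem_insert_of_mem hx)
    obtain ⟨u, hu, hux⟩ := h x (Finset.mem_insert_self _ _)
    refine ⟨s * u, S.mul_mem hs hu, fun z hz => ?_⟩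
    rcases Finset.mem_insert.1 hz with rfl | hz
    · exact hmul _ _ _ hux
    · rw [mul_comm]; exact hmul _ _ _ (hst z hz)

variable [IsNoetherianRing A]

theorem exists_mem_Smin_of {b I : Ideal A} (h : ∀ q ∈ b.minimalPrimes, ¬ I ≤ q) :
    ∃ s ∈ I, s ∈ Smin b := by
  by_contra hcon
  push Not at hcon
  have hsub : (I : Set A) ⊆ ⋃ q ∈ b.minimalPrimes, (q : Set A) := by
    intro s hs
    have := hcon s hs
    rw [mem_Smin] at this
    push Not at this
    simpa using this
  rw [Ideal.subset_union_prime_finite (b.finite_minimalPrimes_of_isNoetherianRing A) ⊥ ⊥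
    (fun q hq _ _ => hq.1.1)] at hsub
  obtain ⟨q, hq, hle⟩ := hsub
  exact h q hq hle

/-- at a minimal prime of `b`, the ideal is nilpotent modulo `b ^ k` up to a unit -/
theorem exists_smul_of_minimal {a b q : Ideal A} (hq : q ∈ b.minimalPrimes) (haq : a ≤ q) (k : ℕ) :
    ∃ s, s ∉ q ∧ ∃ N : ℕ, ∀ r ∈ a ^ N, s * r ∈ b ^ k := by
  have hqp : q.IsPrime := hq.1.1
  let c : Ideal A :=
    { carrier := {x | ∃ s, s ∉ q ∧ s * x ∈ b ^ k}
      zero_mem' := ⟨1, fun h => hqp.ne_top (q.eq_top_iff_one.2 h), by simp⟩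
      add_mem' := by
        rintro x y ⟨s, hs, hx⟩ ⟨t, ht, hy⟩
        refine ⟨s * t, fun h => (hqp.mem_or_mem h).elim hs ht, ?_⟩
        have : s * t * (x + y) = t * (s * x) + s * (t * y) := by ring
        rw [this]
        exact Ideal.add_mem _ (Ideal.mul_mem_left _ _ hx) (Ideal.mul_mem_left _ _ hy)
      smul_mem' := by
        rintro r x ⟨s, hs, hx⟩
        refine ⟨s, hs, ?_⟩
        have : s * (r • x) = r * (s * x) := by simp [smul_eq_mul]; ring
        rw [this]; exact Ideal.mul_mem_left _ _ hx }
  have hrad : a ≤ c.radical := by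
    intro x hx
    by_contra hcon
    let S : Submonoid A := Submonoid.powers x ⊔ q.primeCompl
    have hdis : Disjoint ((b ^ k : Ideal A) : Set A) S := by
      rw [Set.disjoint_left]
      intro z hz hzS
      obtain ⟨_, ⟨n, rfl⟩, s, hs, rfl⟩ := Submonoid.mem_sup.1 hzS
      exact hcon ⟨n, s, hs, by rw [mul_comm]; exact hz⟩
    obtain ⟨p, hp, hbp, hpS⟩ := Ideal.exists_le_prime_disjoint _ S hdis
    have hbp' : b ≤ p := by
      rcases Nat.eq_zero_or_pos k with rfl | hk
      · rw [pow_zero, Ideal.one_eq_top, top_le_iff] at hbp; exact absurd hbp hp.ne_top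
      · exact (Ideal.IsPrime.pow_le_iff hk.ne').1 hbp
    have hpq : p ≤ q := by
      intro z hz
      by_contra hzq
      exact Set.disjoint_left.1 hpS hz (Submonoid.mem_sup_right (S := Submonoid.powers x) (show z ∈ q.primeCompl from hzq))
    have hqp' : q ≤ p := hq.2 ⟨hp, hbp'⟩ hpq
    exact Set.disjoint_left.1 hpS (hqp' (haq hx))
      (Submonoid.mem_sup_left (T := q.primeCompl) (Submonoid.mem_powers x))
  obtain ⟨N, hN⟩ := Ideal.exists_pow_le_of_le_radical_of_fg hrad (IsNoetherian.noetherian a)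
  obtain ⟨t, ht⟩ := IsNoetherian.noetherian (a ^ N)
  obtain ⟨s, hs, hst⟩ := exists_common q.primeCompl t (fun s x => s * x ∈ b ^ k)
    (fun s u x h => by rw [mul_assoc]; exact Ideal.mul_mem_left _ _ h)
    (fun x hx => hN (by rw [← ht]; exact Submodule.subset_span hx))
  refine ⟨s, hs, N, fun r hr => ?_⟩
  rw [← ht] at hr
  induction hr using Submodule.span_induction with
  | mem x hx => exact hst x hx
  | zero => simp
  | add x y _ _ hx hy => rw [mul_add]; exact Ideal.add_mem _ hx hy
  | smul r x _ hx =>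
    rw [smul_eq_mul, mul_left_comm]; exact Ideal.mul_mem_left _ _ hx

theorem artinian_of_support {R T : Type} [CommRing R] [IsNoetherianRing R] [AddCommGroup T]
    [Module R T] [Module.Finite R T]
    (h : ∀ t : T, ∀ p : Ideal R, p.IsPrime → (∀ r : R, r • t = 0 → r ∈ p) → p.IsMaximal) :
    IsArtinian R T := by
  refine artinian_of_killed (c := Module.annihilator R T) ?_ (fun r hr m => Module.mem_annihilator.1 hr m)
  intro p hp hle
  have hmem : (⟨p, hp⟩ : PrimeSpectrum R) ∈ Module.support R T := by
    rw [Module.support_eq_zeroLocus]; exact hle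
  obtain ⟨t, ht⟩ := Module.mem_support_iff_exists_annihilator.1 hmem
  exact h t p hp fun r hr => ht ((Submodule.mem_annihilator_span_singleton t r).2 hr)

theorem isMaximal_loc {b : Ideal A} (p : Ideal (Localization (Smin b))) (hp : p.IsPrime)
    (hbp : b.map (algebraMap A (Localization (Smin b))) ≤ p) : p.IsMaximal := by
  obtain ⟨m, hm, hpm⟩ := p.exists_le_maximal hp.ne_top
  suffices h : m ≤ p by rwa [le_antisymm hpm h]
  have hmp : m.IsPrime := hm.isPrime
  have hq : ∃ q ∈ b.minimalPrimes, m.comap (algebraMap A _) ≤ q := by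
    by_contra hcon
    push Not at hcon
    obtain ⟨s, hs, hsS⟩ := exists_mem_Smin_of hcon
    exact hm.ne_top (Ideal.eq_top_of_isUnit_mem _ hs (IsLocalization.map_units _ (⟨s, hsS⟩ : Smin b)))
  obtain ⟨q, hq, hmq⟩ := hq
  have hle : q ≤ p.comap (algebraMap A (Localization (Smin b))) :=
    hq.2 ⟨Ideal.IsPrime.comap _, Ideal.map_le_iff_le_comap.1 hbp⟩ ((Ideal.comap_mono hpm).trans hmq)
  rw [← IsLocalization.map_comap (Smin b) _ m]
  exact Ideal.map_le_iff_le_comap.2 (hmq.trans hle)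

theorem tor_loc {a : Ideal A} (S : Submonoid A) {M : Type} [AddCommGroup M] [Module A M] (h : Tor a M) :
    Tor (a.map (algebraMap A (Localization S))) (LocalizedModule S M) := by
  intro v
  obtain ⟨⟨m, s⟩, hs⟩ := IsLocalizedModule.surj S (LocalizedModule.mkLinearMap S M) v
  obtain ⟨k, hk⟩ := h m
  refine ⟨k, ?_⟩
  rw [← Ideal.map_pow]
  have : (a ^ k).map (algebraMap A (Localization S)) ≤
      LinearMap.ker (LinearMap.toSpanSingleton (Localization S) _ v) := by
    rw [Ideal.map_le_iff_le_comap]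
    intro r hr
    rw [Ideal.mem_comap, LinearMap.mem_ker, LinearMap.toSpanSingleton_apply, algebraMap_smul]
    apply IsLocalizedModule.smul_injective (LocalizedModule.mkLinearMap S M) s
    dsimp only at hs ⊢
    rw [smul_comm, hs, ← map_smul, hk r hr, map_zero, smul_zero]
  intro r hr
  exact this hr

theorem loc_good {a b : Ideal A} {M : Type} [AddCommGroup M] [Module A M] (ha : Tor a M) (hb : Tor b M)
    (h : Module.Finite A (Submodule.torsionBySet A M (a : Set A))) :
    ∃ F : Finset (Ideal A), (∀ p ∈ F, p.IsPrime ∧ ¬ a ≤ p) ∧ ∀ y ∈ a, (∀ p ∈ F, y ∉ p) →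
      ∃ G : Submodule A M, G.FG ∧ ∀ m : M, ∃ s ∈ Smin b,
        s • m ∈ G ⊔ LinearMap.range (LinearMap.lsmul A M y) := by
  classical
  let S := Smin b
  let L := Localization S
  let P := LocalizedModule S M
  let f : M →ₗ[A] P := LocalizedModule.mkLinearMap S M
  let aL : Ideal L := a.map (algebraMap A L)
  have hLN : IsNoetherianRing L := IsLocalization.isNoetherianRing S L inferInstance
  have hdiv : ∀ (s : S) (v w : P), s • v = w → v = IsLocalization.mk' L 1 s • w := by
    intro s v w h
    rw [← h]
    change v = IsLocalization.mk' L 1 s • ((s : A) • v)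
    rw [← algebraMap_smul L (s : A) v, smul_smul, IsLocalization.mk'_spec, map_one, one_smul]
  have hTfin : Module.Finite L (Submodule.torsionBySet L P (aL : Set L)) := by
    obtain ⟨t, ht⟩ := IsNoetherian.noetherian a
    have hle : Submodule.torsionBySet L P (aL : Set L) ≤
        Submodule.span L (f '' (Submodule.torsionBySet A M (a : Set A))) := by
      intro v hv
      rw [Submodule.mem_torsionBySet_iff] at hv
      obtain ⟨⟨m, s⟩, hs⟩ := IsLocalizedModule.surj S f v
      dsimp only at hs
      obtain ⟨u, hu, hut⟩ := exists_common S t (fun u x => u • x • m = 0)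
        (fun s u x h => by rw [mul_smul, h, smul_zero]) (fun x hx => by
          have h1 : x • v = 0 := by
            rw [← algebraMap_smul L x v]
            exact hv ⟨_, Ideal.mem_map_of_mem _ (by rw [← ht]; exact Submodule.subset_span hx)⟩
          have h2 : f (x • m) = 0 := by
            rw [map_smul, ← hs, smul_comm, h1, smul_zero]
          obtain ⟨u, hu⟩ := (IsLocalizedModule.eq_zero_iff S f).1 h2
          exact ⟨u, u.2, hu⟩)
      have hum : u • m ∈ Submodule.torsionBySet A M (a : Set A) := by
        rw [← ht]
        change u • m ∈ Submodule.torsionBySet A M (Ideal.span (t : Set A) : Set A)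
        rw [← Submodule.torsionBySet_eq_torsionBySet_span, Submodule.mem_torsionBySet_iff]
        rintro ⟨x, hx⟩
        change x • u • m = 0
        rw [smul_comm]; exact hut x hx
      have : v = IsLocalization.mk' L 1 (⟨u, hu⟩ * s) • f (u • m) := by
        apply hdiv
        rw [mul_smul, hs, map_smul]; rfl
      rw [this]
      exact Submodule.smul_mem _ _ (Submodule.subset_span ⟨_, hum, rfl⟩)
    have hfg : (Submodule.span L (f '' (Submodule.torsionBySet A M (a : Set A)))).FG := by
      obtain ⟨t', ht'⟩ := Module.Finite.iff_fg.1 h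
      refine ⟨t'.image f, le_antisymm (Submodule.span_mono ?_) (Submodule.span_le.2 ?_)⟩
      · rw [Finset.coe_image]
        refine Set.image_mono ?_
        rw [← ht']; exact Submodule.subset_span
      · rintro _ ⟨m, hm, rfl⟩
        rw [← ht'] at hm
        have : f m ∈ Submodule.span A (f '' t') := by
          rw [← Submodule.map_span]; exact ⟨m, hm, rfl⟩
        rw [Finset.coe_image]
        exact Submodule.span_subset_span A L _ this
    have := Module.Finite.iff_fg.2 hfg
    exact Module.Finite.of_injective (Submodule.inclusion hle) (Submodule.inclusion_injective hle)
  have hTart : IsArtinian L (Submodule.torsionBySet L P (aL : Set L)) := by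
    refine artinian_of_support fun t p hp hle => isMaximal_loc p hp ?_
    obtain ⟨k, hk⟩ := tor_loc S hb (t : P)
    have h1 : (b.map (algebraMap A L)) ^ k ≤ p := fun r hr => hle r (Subtype.ext (hk r hr))
    rcases Nat.eq_zero_or_pos k with rfl | hk
    · rw [pow_zero, Ideal.one_eq_top, top_le_iff] at h1; exact absurd h1 hp.ne_top
    · exact (Ideal.IsPrime.pow_le_iff hk.ne').1 h1
  have hPart : IsArtinian L P := artinian_of_torsion (tor_loc S ha) hTart
  obtain ⟨F, hF, hG⟩ := exists_good (P := P) hTfin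
  refine ⟨F.image (Ideal.comap (algebraMap A L)), ?_, ?_⟩
  · intro p' hp'
    obtain ⟨p, hp, rfl⟩ := Finset.mem_image.1 hp'
    have := (hF p hp).1
    exact ⟨Ideal.IsPrime.comap _, fun hle => (hF p hp).2 (Ideal.map_le_iff_le_comap.2 hle)⟩
  · intro y hy hyF
    have hfin := hG (algebraMap A L y) (Ideal.mem_map_of_mem _ hy)
      (fun p hp hmem => hyF _ (Finset.mem_image_of_mem _ hp) hmem)
    obtain ⟨t, ht⟩ := hfin.fg_top
    have hch : ∀ z : (P ⧸ LinearMap.range (LinearMap.lsmul L P (algebraMap A L y))), ∃ m : M, ∃ s : S,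
        ∃ v : P, Submodule.Quotient.mk v = z ∧ s • v = f m := by
      intro z
      obtain ⟨v, rfl⟩ := Submodule.mkQ_surjective _ z
      obtain ⟨⟨m, s⟩, hs⟩ := IsLocalizedModule.surj S f v
      exact ⟨m, s, v, rfl, hs⟩
    choose mm ss vv h1 h2 using hch
    let G : Submodule A M := Submodule.span A (t.image mm : Finset M)
    refine ⟨G, ⟨_, rfl⟩, ?_⟩
    let G' := G ⊔ LinearMap.range (LinearMap.lsmul A M y)
    have htop : Submodule.localized' L S f G' = ⊤ := by
      rw [eq_top_iff]
      have hR : LinearMap.range (LinearMap.lsmul L P (algebraMap A L y)) ≤ Submodule.localized' L S f G' := by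
        rintro _ ⟨v, rfl⟩
        obtain ⟨⟨m, s⟩, hs⟩ := IsLocalizedModule.surj S f v
        rw [LinearMap.lsmul_apply, hdiv s v _ hs, smul_comm]
        refine Submodule.smul_mem _ _ ?_
        rw [algebraMap_smul, ← map_smul]
        exact ⟨y • m, Submodule.mem_sup_right ⟨m, rfl⟩, 1, by simp⟩
      intro v _
      have hv : Submodule.Quotient.mk v ∈ Submodule.span L (t : Set (P ⧸ LinearMap.range (LinearMap.lsmul L P (algebraMap A L y)))) := by
        rw [ht]; trivial
      have hle : Submodule.span L (t : Set (P ⧸ LinearMap.range (LinearMap.lsmul L P (algebraMap A L y)))) ≤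
          (Submodule.localized' L S f G').map (Submodule.mkQ _) := by
        rw [Submodule.span_le]
        intro z hz
        refine ⟨vv z, ?_, h1 z⟩
        rw [hdiv (ss z) (vv z) _ (h2 z)]
        refine Submodule.smul_mem _ _ ⟨mm z, Submodule.mem_sup_left (Submodule.subset_span ?_), 1, by simp⟩
        exact Finset.mem_image_of_mem _ hz
      obtain ⟨w, hw, hwv⟩ := hle hv
      have h3 : v - w ∈ LinearMap.range (LinearMap.lsmul L P (algebraMap A L y)) :=
        (Submodule.Quotient.eq _).1 hwv.symm
      simpa using Submodule.add_mem _ (hR h3) hw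
    intro m
    have hm : f m ∈ Submodule.localized' L S f G' := by rw [htop]; trivial
    obtain ⟨g, hg, s, hgs⟩ := hm
    rw [IsLocalizedModule.mk'_eq_iff] at hgs
    have : f g = f (s • m) := by rw [hgs]; exact (map_smul f (s : A) m).symm
    obtain ⟨u, hu⟩ := (IsLocalizedModule.eq_iff_exists S f).1 this
    refine ⟨u * s, (u * s).2, ?_⟩
    have h4 : ((u : A) * s) • m = (u : A) • g := by rw [mul_smul]; exact hu.symm
    rw [h4]
    exact G'.smul_mem _ hg


/-- `a`-torsion submodule -/
def Gam (a : Ideal A) (M : Type) [AddCommGroup M] [Module A M] : Submodule A M where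
  carrier := {m | ∃ k : ℕ, ∀ r ∈ a ^ k, r • m = 0}
  zero_mem' := ⟨0, fun r _ => smul_zero r⟩
  add_mem' := by
    rintro x y ⟨k, hk⟩ ⟨l, hl⟩
    refine ⟨k + l, fun r hr => ?_⟩
    rw [smul_add, hk r (Ideal.pow_le_pow_right (Nat.le_add_right _ _) hr),
      hl r (Ideal.pow_le_pow_right (Nat.le_add_left _ _) hr), add_zero]
  smul_mem' := by
    rintro c x ⟨k, hk⟩
    exact ⟨k, fun r hr => by rw [smul_comm, hk r hr, smul_zero]⟩

theorem tor_Gam (a : Ideal A) (M : Type) [AddCommGroup M] [Module A M] : Tor a (Gam a M) := by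
  rintro ⟨m, k, hk⟩
  exact ⟨k, fun r hr => Subtype.ext (hk r hr)⟩

theorem q_good {a b : Ideal A} {M : Type} [AddCommGroup M] [Module A M] (hb : Tor b M)
    (h : EF A (A ⧸ a) M 0) :
    ∃ F : Finset (Ideal A), (∀ p ∈ F, p.IsPrime ∧ ¬ a ≤ p) ∧ ∀ y ∈ a, (∀ p ∈ F, y ∉ p) →
      ∃ G : Submodule A M, G.FG ∧ ∀ m : M, ∃ s ∈ Smin b,
        s • m ∈ G ⊔ LinearMap.range (LinearMap.lsmul A M y) := by
  classical
  have hfin : Module.Finite A (Submodule.torsionBySet A (Gam a M) (a : Set A)) :=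
    EF_zero_iff.1 (EF.sub (Gam a M).injective_subtype h)
  obtain ⟨F, hF, hG⟩ := loc_good (tor_Gam a M)
    (Tor.of_inj (Gam a M).subtype (Gam a M).injective_subtype hb) hfin
  have hmf := b.finite_minimalPrimes_of_isNoetherianRing A
  refine ⟨F ∪ hmf.toFinset.filter (fun q => ¬ a ≤ q), ?_, ?_⟩
  · intro p hp
    rcases Finset.mem_union.1 hp with hp | hp
    · exact hF p hp
    · rw [Finset.mem_filter, Set.Finite.mem_toFinset] at hp
      exact ⟨hp.1.1.1, hp.2⟩
  · intro y hy hyF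
    obtain ⟨G, hGfg, hGs⟩ := hG y hy fun p hp => hyF p (Finset.mem_union_left _ hp)
    refine ⟨G.map (Gam a M).subtype, hGfg.map _, fun m => ?_⟩
    obtain ⟨k, hk⟩ := hb m
    -- saturation ideal
    let sat : Ideal A :=
      { carrier := {t | ∃ N : ℕ, ∀ r ∈ a ^ N, t * r ∈ b ^ k}
        zero_mem' := ⟨0, by simp⟩
        add_mem' := by
          rintro t t' ⟨N, hN⟩ ⟨N', hN'⟩
          refine ⟨N + N', fun r hr => ?_⟩
          rw [add_mul]
          exact Ideal.add_mem _ (hN r (Ideal.pow_le_pow_right (Nat.le_add_right _ _) hr))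
            (hN' r (Ideal.pow_le_pow_right (Nat.le_add_left _ _) hr))
        smul_mem' := by
          rintro c t ⟨N, hN⟩
          refine ⟨N, fun r hr => ?_⟩
          rw [smul_eq_mul, mul_assoc]; exact Ideal.mul_mem_left _ _ (hN r hr) }
    obtain ⟨s, hs, hsS⟩ := exists_mem_Smin_of (b := b) (I := Ideal.span {y} ⊔ sat) (by
      intro q hq hle
      have hyq : y ∈ q := hle (Ideal.mem_sup_left (Ideal.mem_span_singleton_self y))
      have haq : a ≤ q := by
        by_contra hcon
        exact hyF q (Finset.mem_union_right _ (by
          rw [Finset.mem_filter, Set.Finite.mem_toFinset]; exact ⟨hq, hcon⟩)) hyq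
      obtain ⟨s, hsq, N, hN⟩ := exists_smul_of_minimal hq haq k
      exact hsq (hle (Ideal.mem_sup_right ⟨N, hN⟩)))
    obtain ⟨u, hu, t, ⟨N, hN⟩, rfl⟩ := Submodule.mem_sup.1 hs
    obtain ⟨c, rfl⟩ := Ideal.mem_span_singleton'.1 hu
    have htm : t • m ∈ Gam a M := ⟨N, fun r hr => by
      rw [smul_smul, mul_comm]; exact hk _ (hN r hr)⟩
    obtain ⟨s', hs', hmem⟩ := hGs ⟨t • m, htm⟩
    refine ⟨s' * (c * y + t), (Smin b).mul_mem hs' hsS, ?_⟩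
    have h1 : (s' * (c * y + t)) • m = s' • (t • m) + y • ((s' * c) • m) := by
      rw [smul_smul, smul_smul, ← add_smul]; congr 1; ring
    rw [h1]
    refine Submodule.add_mem _ ?_ (Submodule.mem_sup_right ⟨_, rfl⟩)
    have h2 := Submodule.mem_map_of_mem (f := (Gam a M).subtype) hmem
    rw [Submodule.map_sup] at h2
    have h3 : (LinearMap.range (LinearMap.lsmul A (Gam a M) y)).map (Gam a M).subtype ≤
        LinearMap.range (LinearMap.lsmul A M y) := by
      rintro _ ⟨_, ⟨v, rfl⟩, rfl⟩
      exact ⟨v, rfl⟩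
    have h4 := sup_le_sup (le_refl (G.map (Gam a M).subtype)) h3
    exact h4 h2

theorem exists_avoid {a J : Ideal A} (F : Finset (Ideal A)) (hF : ∀ p ∈ F, p.IsPrime ∧ ¬ a ≤ p)
    (hJ : ¬ a ≤ J) : ∃ y ∈ a, y ∉ J ∧ ∀ p ∈ F, y ∉ p := by
  classical
  by_contra hcon
  push Not at hcon
  have hsub : (a : Set A) ⊆ ⋃ q ∈ ((insert J F : Finset (Ideal A)) : Set (Ideal A)), (q : Set A) := by
    intro y hy
    by_cases hyJ : y ∈ J
    · exact Set.mem_biUnion (x := J) (by simp) hyJ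
    · obtain ⟨p, hp, hyp⟩ := hcon y hy hyJ
      exact Set.mem_biUnion (x := p) (by simp [hp]) hyp
  rw [Ideal.subset_union_prime (f := fun q : Ideal A => q) J J] at hsub
  · obtain ⟨q, hq, hle⟩ := hsub
    rcases Finset.mem_insert.1 hq with rfl | hq
    · exact hJ hle
    · exact (hF q hq).2 hle
  · intro q hq hqJ _
    rcases Finset.mem_insert.1 hq with rfl | hq
    · exact absurd rfl hqJ
    · exact (hF q hq).1

theorem quot_killed (a : Ideal A) : ∀ r ∈ a, ∀ n : A ⧸ a, r • n = 0 := by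
  intro r hr n
  obtain ⟨n, rfl⟩ := Ideal.Quotient.mk_surjective n
  rw [Algebra.smul_def]
  exact Ideal.Quotient.eq_zero_iff_mem.2 (a.mul_mem_right _ hr)

theorem post_lsmul_zero {a : Ideal A} {y : A} (hy : y ∈ a) (M : Type) [AddCommGroup M] [Module A M]
    (i : ℕ) : post (A ⧸ a) (LinearMap.lsmul A M y) i = 0 := by
  refine post_eq_zero_of_mem (quot_killed a) _ ?_ i
  have : LinearMap.lsmul A M y = y • LinearMap.id := by ext; rfl
  rw [this]; exact Submodule.smul_mem_smul hy trivial

/-- the dimension one theorem -/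
theorem P1 {a b : Ideal A} (hmax : ∀ m : Ideal A, m.IsMaximal → b ≤ m → a ≤ m)
    (hch : ∀ p₀ p₁ p₂ : Ideal A, p₀.IsPrime → p₁.IsPrime → p₂.IsPrime → b ≤ p₀ → p₀ < p₁ → p₁ < p₂ → False)
    {M : Type} [AddCommGroup M] [Module A M] (hb : Tor b M)
    (h0 : EF A (A ⧸ a) M 0) (h1 : EF A (A ⧸ a) M 1) : ∀ i, EF A (A ⧸ a) M i := by
  suffices key : ∀ J : Ideal A, ∀ (M : Type) [AddCommGroup M] [Module A M], (∀ r ∈ J, ∀ m : M, r • m = 0) →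
      Tor b M → EF A (A ⧸ a) M 0 → EF A (A ⧸ a) M 1 → ∀ i, EF A (A ⧸ a) M i from
    key ⊥ M (fun r hr m => by rw [(Submodule.mem_bot A).1 hr, zero_smul]) hb h0 h1
  intro J
  induction J using WellFoundedGT.induction with
  | _ J ih =>
  intro M _ _ hJ hb h0 h1
  by_cases haJ : a ≤ J
  · have : Module.Finite A M := by
      rw [EF_zero_iff] at h0
      refine Module.Finite.of_surjective (Submodule.subtype _) (fun v => ⟨⟨v, ?_⟩, rfl⟩)
        (M := Submodule.torsionBySet A M (a : Set A))
      rw [Submodule.mem_torsionBySet_iff]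
      exact fun r => hJ r.1 (haJ r.2) v
    exact fun i => EF.of_finite i
  obtain ⟨F, hF, hG⟩ := q_good hb h0
  obtain ⟨y, hy, hyJ, hyF⟩ := exists_avoid F hF haJ
  obtain ⟨G, hGfg, hGs⟩ := hG y hy hyF
  let f : M →ₗ[A] M := LinearMap.lsmul A M y
  have hses := ses_ker f.rangeRestrict f.surjective_rangeRestrict
  rw [LinearMap.ker_rangeRestrict] at hses
  have hr0 : EF A (A ⧸ a) (LinearMap.range f) 0 := EF.sub (Submodule.injective_subtype _) h0
  have hL : ∀ i, EF A (A ⧸ a) (LinearMap.ker f) i := by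
    refine ih (J ⊔ Ideal.span {y}) ?_ _ ?_ (Tor.of_inj _ (Submodule.injective_subtype _) hb)
      (EF.sub (Submodule.injective_subtype _) h0) (hses.EF1 hr0 h1)
    · refine lt_of_le_of_ne le_sup_left fun h => hyJ ?_
      rw [h]; exact Ideal.mem_sup_right (Ideal.mem_span_singleton_self y)
    · rintro r hr ⟨m, hm⟩
      obtain ⟨j, hj, u, hu, rfl⟩ := Submodule.mem_sup.1 hr
      obtain ⟨c, rfl⟩ := Ideal.mem_span_singleton'.1 hu
      refine Subtype.ext ?_
      change (j + c * y) • m = 0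
      rw [add_smul, hJ j hj, mul_smul, show y • m = 0 from hm, smul_zero, add_zero]
  have hr1 : EF A (A ⧸ a) (LinearMap.range f) 1 := hses.EF3 h1 (hL 2)
  have hQ0 : EF A (A ⧸ a) (M ⧸ LinearMap.range f) 0 := (ses_sub (LinearMap.range f)).EF3 h0 hr1
  have hQ : ∀ i, EF A (A ⧸ a) (M ⧸ LinearMap.range f) i := by
    let Q := M ⧸ LinearMap.range f
    let Q' : Submodule A Q := G.map (LinearMap.range f).mkQ
    have hQ'fin : Module.Finite A Q' := Module.Finite.iff_fg.2 (hGfg.map _)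
    have hR0 : EF A (A ⧸ a) (Q ⧸ Q') 0 := (ses_sub Q').EF3 hQ0 (EF.of_finite 1)
    have hbR : Tor b (Q ⧸ Q') := Tor.of_surj _ Q'.mkQ_surjective
      (Tor.of_surj _ (LinearMap.range f).mkQ_surjective hb)
    have hsR : ∀ z : Q ⧸ Q', ∃ s ∈ Smin b, s • z = 0 := by
      intro z
      obtain ⟨z, rfl⟩ := Q'.mkQ_surjective z
      obtain ⟨m, rfl⟩ := (LinearMap.range f).mkQ_surjective z
      obtain ⟨s, hs, hsm⟩ := hGs m
      refine ⟨s, hs, ?_⟩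
      rw [← map_smul, ← map_smul, Submodule.mkQ_apply, Submodule.Quotient.mk_eq_zero]
      obtain ⟨g, hg, w, hw, hgw⟩ := Submodule.mem_sup.1 hsm
      refine ⟨g, hg, ?_⟩
      rw [← hgw, map_add]
      have : (LinearMap.range f).mkQ w = 0 := (Submodule.Quotient.mk_eq_zero _).2 hw
      rw [this, add_zero]
    have hp : ∀ z : Q ⧸ Q', ∀ p : Ideal A, p.IsPrime → (∀ r : A, r • z = 0 → r ∈ p) →
        b ≤ p ∧ p.IsMaximal := by
      intro z p hp hle
      obtain ⟨k, hk⟩ := hbR z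
      have hbp : b ≤ p := by
        have h1 : b ^ k ≤ p := fun r hr => hle r (hk r hr)
        rcases Nat.eq_zero_or_pos k with rfl | hk
        · rw [pow_zero, Ideal.one_eq_top, top_le_iff] at h1; exact absurd h1 hp.ne_top
        · exact (Ideal.IsPrime.pow_le_iff hk.ne').1 h1
      refine ⟨hbp, ?_⟩
      obtain ⟨s, hs, hsz⟩ := hsR z
      obtain ⟨q, hq, hqp⟩ := Ideal.exists_minimalPrimes_le hbp
      have hlt : q < p := lt_of_le_of_ne hqp fun h => hs q hq (by rw [h]; exact hle s hsz)
      obtain ⟨m, hm, hpm⟩ := p.exists_le_maximal hp.ne_top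
      rcases eq_or_lt_of_le hpm with h | h
      · rw [h]; exact hm
      · exact (hch q p m hq.1.1 hp hm.isPrime hq.1.2 hlt h).elim
    have haR : Tor a (Q ⧸ Q') := by
      intro z
      have hrad : a ≤ Ideal.radical (LinearMap.ker (LinearMap.toSpanSingleton A (Q ⧸ Q') z)) := by
        rw [Ideal.radical_eq_sInf]
        refine le_sInf ?_
        rintro p ⟨hle, hp'⟩
        obtain ⟨h1, h2⟩ := hp z p hp' fun r hr => hle hr
        exact hmax p h2 h1
      obtain ⟨k, hk⟩ := Ideal.exists_pow_le_of_le_radical_of_fg hrad (IsNoetherian.noetherian a)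
      exact ⟨k, fun r hr => hk hr⟩
    have hTf : Module.Finite A (Submodule.torsionBySet A (Q ⧸ Q') (a : Set A)) := EF_zero_iff.1 hR0
    have hTa : IsArtinian A (Submodule.torsionBySet A (Q ⧸ Q') (a : Set A)) :=
      artinian_of_support fun t p hp' hle => (hp t p hp' fun r hr => hle r (Subtype.ext hr)).2
    have : IsArtinian A (Q ⧸ Q') := artinian_of_torsion haR hTa
    exact fun i => (ses_sub Q').EF2 (EF.of_finite i) (P0 hR0 i)
  intro i
  exact EF.of_post_zero f i (post_lsmul_zero hy M i) (hL i) fun j _ => hQ j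

end P1
end CF

namespace CF

section LemA

theorem Tor.sup {a b : Ideal A} {M : Type} [AddCommGroup M] [Module A M] (ha : Tor a M) (hb : Tor b M) :
    Tor (a ⊔ b) M := by
  intro m
  obtain ⟨k, hk⟩ := ha m
  obtain ⟨l, hl⟩ := hb m
  refine ⟨k + l, fun r hr => ?_⟩
  obtain ⟨x, hx, y, hy, rfl⟩ := Submodule.mem_sup.1 (Ideal.sup_pow_add_le_pow_sup_pow hr)
  rw [add_smul, hk x hx, hl y hy, add_zero]

theorem Tor.span {u : A} {M : Type} [AddCommGroup M] [Module A M] (h : ∀ m : M, ∃ k : ℕ, u ^ k • m = 0) :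
    Tor (Ideal.span {u}) M := by
  intro m
  obtain ⟨k, hk⟩ := h m
  refine ⟨k, fun r hr => ?_⟩
  rw [Ideal.span_singleton_pow] at hr
  obtain ⟨c, rfl⟩ := Ideal.mem_span_singleton'.1 hr
  rw [mul_smul, hk, smul_zero]

variable [IsNoetherianRing A]

theorem tor_loc' {a : Ideal A} (S : Submonoid A) {M : Type} [AddCommGroup M] [Module A M] (h : Tor a M) :
    Tor a (LocalizedModule S M) := by
  intro v
  obtain ⟨k, hk⟩ := tor_loc S h v
  refine ⟨k, fun r hr => ?_⟩
  rw [← algebraMap_smul (Localization S) r v]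
  exact hk _ (by rw [← Ideal.map_pow]; exact Ideal.mem_map_of_mem _ hr)

theorem exists_avoid' {a : Ideal A} (F : Finset (Ideal A)) (hF : ∀ p ∈ F, p.IsPrime ∧ ¬ a ≤ p) :
    ∃ y ∈ a, ∀ p ∈ F, y ∉ p := by
  rcases F.eq_empty_or_nonempty with rfl | ⟨J, hJ⟩
  · exact ⟨0, a.zero_mem, by simp⟩
  · obtain ⟨y, hy, -, h⟩ := exists_avoid F hF (hF J hJ).2
    exact ⟨y, hy, h⟩

theorem lemmaA [IsLocalRing A] {p b : Ideal A} (hp : p.IsPrime)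
    (hchp : ∀ p₀ p₁ p₂ : Ideal A, p₀.IsPrime → p₁.IsPrime → p₂.IsPrime → p ≤ p₀ → p₀ < p₁ → p₁ < p₂ → False)
    (hch : ∀ p₀ p₁ p₂ p₃ : Ideal A, p₀.IsPrime → p₁.IsPrime → p₂.IsPrime → p₃.IsPrime →
      b ≤ p₀ → p₀ < p₁ → p₁ < p₂ → p₂ < p₃ → False)
    {M : Type} [AddCommGroup M] [Module A M] (hb : Tor b M)
    (h : ∀ i ≤ 2, EF A (A ⧸ p) M i) : ∀ i, EF A (A ⧸ p) M i := by
  classical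
  have hmf := b.finite_minimalPrimes_of_isNoetherianRing A
  obtain ⟨u, hu, huF⟩ := exists_avoid' (a := p) (hmf.toFinset.filter (fun q => ¬ p ≤ q)) (by
    intro q hq
    rw [Finset.mem_filter, Set.Finite.mem_toFinset] at hq
    exact ⟨hq.1.1.1, hq.2⟩)
  let b' := b ⊔ Ideal.span {u}
  have hP1 : ∀ (N : Type) [AddCommGroup N] [Module A N], Tor b' N → EF A (A ⧸ p) N 0 → EF A (A ⧸ p) N 1 →
      ∀ i, EF A (A ⧸ p) N i := by
    intro N _ _ hN h0 h1
    refine P1 (b := b') ?_ ?_ hN h0 h1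
    · intro m hm _
      rw [IsLocalRing.eq_maximalIdeal hm]
      exact IsLocalRing.le_maximalIdeal hp.ne_top
    · intro p₀ p₁ p₂ h0 h1 h2 hle h01 h12
      obtain ⟨q, hq, hqp⟩ := Ideal.exists_minimalPrimes_le (le_sup_left.trans hle : b ≤ p₀)
      rcases eq_or_lt_of_le hqp with rfl | hlt
      · have huq : u ∈ q := hle (Ideal.mem_sup_right (Ideal.mem_span_singleton_self u))
        have hpq : p ≤ q := by
          by_contra hcon
          exact huF q (by rw [Finset.mem_filter, Set.Finite.mem_toFinset]; exact ⟨hq, hcon⟩) huq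
        exact hchp q p₁ p₂ h0 h1 h2 hpq h01 h12
      · exact hch q p₀ p₁ p₂ hq.1.1 h0 h1 h2 hq.1.2 hlt h01 h12
  let S := Submonoid.powers u
  let f : M →ₗ[A] LocalizedModule S M := LocalizedModule.mkLinearMap S M
  have hU : ∀ i, EF A (A ⧸ p) (LocalizedModule S M) i := by
    intro i
    refine EF.of_subsingleton (xt_subsingleton (quot_killed p u hu) ?_ i)
    have := IsLocalizedModule.map_units f (⟨u, Submonoid.mem_powers u⟩ : S)
    exact (Module.End.isUnit_iff _).1 this
  have hses := ses_ker f.rangeRestrict f.surjective_rangeRestrict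
  rw [LinearMap.ker_rangeRestrict] at hses
  have hses2 := ses_sub (LinearMap.range f)
  have hR0 : EF A (A ⧸ p) (LinearMap.range f) 0 := EF.sub (Submodule.injective_subtype _) (hU 0)
  have hK : ∀ i, EF A (A ⧸ p) (LinearMap.ker f) i := by
    refine hP1 _ ?_ (EF.sub (Submodule.injective_subtype _) (h 0 (by omega))) (hses.EF1 hR0 (h 1 (by omega)))
    refine Tor.sup (Tor.of_inj _ (Submodule.injective_subtype _) hb) (Tor.span ?_)
    rintro ⟨m, hm⟩
    obtain ⟨⟨_, k, rfl⟩, hk⟩ := (IsLocalizedModule.eq_zero_iff S f).1 hm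
    exact ⟨k, Subtype.ext hk⟩
  have hR : ∀ i ≤ 2, EF A (A ⧸ p) (LinearMap.range f) i := fun i hi => hses.EF3 (h i hi) (hK _)
  have hC : ∀ i, EF A (A ⧸ p) (LocalizedModule S M ⧸ LinearMap.range f) i := by
    refine hP1 _ ?_ (hses2.EF3 (hU 0) (hR 1 (by omega))) (hses2.EF3 (hU 1) (hR 2 (by omega)))
    refine Tor.sup (Tor.of_surj _ (Submodule.mkQ_surjective _) (tor_loc' S hb)) (Tor.span ?_)
    intro z
    obtain ⟨v, rfl⟩ := Submodule.mkQ_surjective _ z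
    obtain ⟨⟨m, ⟨_, k, rfl⟩⟩, hs⟩ := IsLocalizedModule.surj S f v
    refine ⟨k, ?_⟩
    rw [← map_smul, Submodule.mkQ_apply, Submodule.Quotient.mk_eq_zero]
    exact ⟨m, hs.symm⟩
  intro i
  refine hses.EF2 (hK i) ?_
  cases i with
  | zero => exact hR0
  | succ i => exact hses2.EF1 (hC i) (hU (i + 1))

end LemA
end CF

namespace CF

section Tate
open IsLocalRing

theorem pi_precomplete (I : Ideal A) [IsPrecomplete I A] (n : ℕ) : IsPrecomplete I (Fin n → A) := by
  constructor
  intro f hf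
  have key : ∀ (k : ℕ) (v : Fin n → A), v ∈ (I ^ k • ⊤ : Submodule A (Fin n → A)) ↔ ∀ j, v j ∈ I ^ k := by
    intro k v
    constructor
    · intro hv j
      have := Submodule.mem_map_of_mem (f := LinearMap.proj (R := A) (φ := fun _ : Fin n => A) j) hv
      rw [Submodule.map_smul''] at this
      have h2 : v j ∈ I ^ k • (⊤ : Submodule A A) := Submodule.smul_mono le_rfl le_top this
      simpa using h2
    · intro hv
      have : v = ∑ j, v j • Pi.single j (1 : A) := by
        ext i; simp [Finset.sum_apply, Pi.single_apply]
      rw [this]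
      exact Submodule.sum_mem _ fun j _ => Submodule.smul_mem_smul (hv j) trivial
  have h1 : ∀ j : Fin n, ∃ L : A, ∀ k, f k j ≡ L [SMOD (I ^ k • ⊤ : Submodule A A)] := by
    intro j
    refine IsPrecomplete.prec' (fun k => f k j) ?_
    intro m k hmk
    have := (SModEq.sub_mem.1 (hf hmk))
    rw [SModEq.sub_mem]
    simpa using (key _ _).1 this j
  choose L hL using h1
  refine ⟨L, fun k => ?_⟩
  rw [SModEq.sub_mem, key]
  intro j
  have := SModEq.sub_mem.1 (hL j k)
  simpa using this

variable {T : Type} [AddCommGroup T] [Module A T]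

/-- the Tate module of `T` along `x` -/
def tate (x : A) (T : Type) [AddCommGroup T] [Module A T] : Submodule A (ℕ → T) where
  carrier := {t | t 0 = 0 ∧ ∀ n, x • t (n + 1) = t n}
  zero_mem' := ⟨rfl, fun n => by simp⟩
  add_mem' := by
    rintro s t ⟨hs, hs'⟩ ⟨ht, ht'⟩
    exact ⟨by simp [hs, ht], fun n => by simp [smul_add, hs', ht']⟩
  smul_mem' := by
    rintro r t ⟨ht, ht'⟩
    exact ⟨by simp [ht], fun n => by simp [smul_comm x r, ht']⟩

theorem tate_lift {x : A} (hs : ∀ t : T, ∃ s, x • s = t) (k : ℕ) (t : T) (ht : x ^ k • t = 0) :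
    ∃ v ∈ tate x T, v k = t := by
  choose g hg using hs
  have hgp : ∀ (j : ℕ) (u : T), x • g^[j + 1] u = g^[j] u := by
    intro j u
    rw [Function.iterate_succ_apply', hg]
  refine ⟨fun n => if n ≤ k then x ^ (k - n) • t else g^[n - k] t, ⟨by simp [ht], ?_⟩, by simp⟩
  intro n
  by_cases h1 : n + 1 ≤ k
  · have h2 : n ≤ k := by omega
    simp only [h1, h2, if_true]
    rw [smul_smul, ← pow_succ']; congr 2; omega
  · by_cases h2 : n ≤ k
    · have h3 : n = k := by omega
      subst h3
      simp [hg]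
    · simp only [h1, h2, if_false]
      rw [show n + 1 - k = (n - k) + 1 by omega, hgp]

theorem tate_shift {x : A} {t : ℕ → T} (ht : t ∈ tate x T) (h1 : t 1 = 0) :
    ∃ s ∈ tate x T, x • s = t := by
  refine ⟨fun n => t (n + 1), ⟨h1, fun n => ht.2 (n + 1)⟩, ?_⟩
  funext n
  exact ht.2 n

theorem tate_pow_zero {x : A} {t : ℕ → T} (ht : t ∈ tate x T) (k : ℕ) : x ^ k • t k = 0 := by
  induction k with
  | zero => simp [ht.1]
  | succ k ih => rw [pow_succ, mul_smul, ht.2, ih]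

variable [IsNoetherianRing A] [IsLocalRing A] [IsAdicComplete (maximalIdeal A) A]

theorem exists_kill {x z : A} (hx : x ∈ maximalIdeal A) (hz : z ∈ maximalIdeal A)
    (hfin : Module.Finite A (LinearMap.ker (LinearMap.lsmul A T x)))
    {e : ℕ} (he : ∀ r ∈ maximalIdeal A ^ e, ∀ t : T, x • t = 0 → r • t = 0)
    (hs : ∀ t : T, ∃ s, x • s = t) (htor : ∀ t : T, ∃ k : ℕ, x ^ k • t = 0) :
    ∃ (K : ℕ) (c : A), ∀ t : T, (z ^ K + x * c) • t = 0 := by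
  let m := maximalIdeal A
  let V := tate x T
  have hxk : ∀ v ∈ V, x • v 1 = 0 := fun v hv => by rw [hv.2, hv.1]
  have hme : ∀ r ∈ m ^ e, ∀ v : V, ∃ w : V, r • v = x • w := by
    rintro r hr ⟨v, hv⟩
    obtain ⟨s, hs, hsv⟩ := tate_shift (V.smul_mem r hv) (he r hr _ (hxk v hv))
    exact ⟨⟨s, hs⟩, Subtype.ext hsv.symm⟩
  have hmek : ∀ k : ℕ, ∀ v ∈ ((m ^ e) ^ k • ⊤ : Submodule A V), ∃ w : V, v = x ^ k • w := by
    intro k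
    induction k with
    | zero => intro v _; exact ⟨v, by simp⟩
    | succ k ih =>
      intro v hv
      rw [pow_succ', mul_smul] at hv
      refine Submodule.smul_induction_on hv ?_ ?_
      · intro r hr w hw
        obtain ⟨w', rfl⟩ := ih w hw
        obtain ⟨u, hu⟩ := hme r hr w'
        exact ⟨u, by rw [smul_comm, hu, smul_smul, ← pow_succ]⟩
      · rintro v w ⟨v', rfl⟩ ⟨w', rfl⟩
        exact ⟨v' + w', by rw [smul_add]⟩
  have hH : IsHausdorff m V := by
    constructor
    intro v hv
    refine Subtype.ext (funext fun k => ?_)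
    obtain ⟨w, hw⟩ := hmek k v (by
      have := hv (e * k)
      rw [SModEq.zero, pow_mul] at this
      exact this)
    rw [hw]
    exact tate_pow_zero w.2 k
  obtain ⟨n, f, hf⟩ := Module.Finite.exists_fin' A (LinearMap.ker (LinearMap.lsmul A T x))
  have hl : ∀ j : Fin n, ∃ v : V, v.1 1 = (f (Pi.single j 1)).1 := by
    intro j
    obtain ⟨v, hv, h⟩ := tate_lift hs 1 (f (Pi.single j 1)).1 (by rw [pow_one]; exact (f (Pi.single j 1)).2)
    exact ⟨⟨v, hv⟩, h⟩
  choose g hg using hl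
  let F : (Fin n → A) →ₗ[A] V := Fintype.linearCombination A g
  have hFs : Function.Surjective F := by
    have := pi_precomplete m n
    refine surjective_of_mkQ_comp_surjective (I := m) ?_
    intro q
    obtain ⟨v, rfl⟩ := Submodule.mkQ_surjective _ q
    obtain ⟨c, hc⟩ := hf ⟨v.1 1, hxk _ v.2⟩
    have h1 : (F c).1 1 = v.1 1 := by
      have h2 : c = ∑ j, c j • Pi.single j (1 : A) := by
        ext i; simp [Finset.sum_apply, Pi.single_apply]
      have h3 : (v.1 1 : T) = (f c).1 := by rw [hc]
      rw [h3]
      conv_rhs => rw [h2]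
      rw [map_sum]
      simp only [F, Fintype.linearCombination_apply]
      simp [Finset.sum_apply, hg]
    refine ⟨c, ?_⟩
    obtain ⟨s, hsV, hsx⟩ := tate_shift (V.sub_mem (F c).2 v.2) (by simp [h1])
    rw [LinearMap.comp_apply, ← sub_eq_zero, ← map_sub, Submodule.mkQ_apply, Submodule.Quotient.mk_eq_zero]
    have : F c - v = x • (⟨s, hsV⟩ : V) := Subtype.ext hsx.symm
    rw [this]
    exact Submodule.smul_mem_smul hx trivial
  have hVfin : Module.Finite A V := Module.Finite.of_surjective F hFs
  obtain ⟨p, hpm, -, hpc, hp0⟩ := LinearMap.exists_monic_and_natDegree_eq_and_coeff_mem_pow_and_aeval_eq_zero A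
    (LinearMap.lsmul A V (z ^ e) : Module.End A V) (Ideal.span {x}) (by
      rintro _ ⟨v, rfl⟩
      obtain ⟨w, hw⟩ := hme (z ^ e) (Ideal.pow_mem_pow hz e) v
      rw [LinearMap.lsmul_apply, hw]
      exact Submodule.smul_mem_smul (Ideal.mem_span_singleton_self x) trivial)
  have hev : ∀ (q : Polynomial A) (v : V),
      Polynomial.aeval (LinearMap.lsmul A V (z ^ e) : Module.End A V) q v = q.eval (z ^ e) • v := by
    intro q v
    have : (LinearMap.lsmul A V (z ^ e) : Module.End A V) = algebraMap A (Module.End A V) (z ^ e) := by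
      ext; rfl
    rw [this, Polynomial.aeval_algebraMap_apply]
    rfl
  have hd : p.eval (z ^ e) - (z ^ e) ^ p.natDegree ∈ Ideal.span {x} := by
    rw [Polynomial.eval_eq_sum_range, Finset.sum_range_succ, hpm.coeff_natDegree, one_mul, add_sub_cancel_right]
    refine Ideal.sum_mem _ fun k hk => Ideal.mul_mem_right _ _ ?_
    exact Ideal.pow_le_self (by have := Finset.mem_range.1 hk; omega) (hpc k)
  obtain ⟨c, hc⟩ := Ideal.mem_span_singleton'.1 hd
  refine ⟨e * p.natDegree, c, fun t => ?_⟩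
  obtain ⟨k, hk⟩ := htor t
  obtain ⟨v, hv, hvt⟩ := tate_lift hs k t hk
  have h1 : z ^ (e * p.natDegree) + x * c = p.eval (z ^ e) := by
    rw [pow_mul, mul_comm x c, hc]; ring
  have h2 := hev p ⟨v, hv⟩
  rw [hp0] at h2
  have h3 := congrFun (congrArg Subtype.val h2) k
  rw [h1, ← hvt]
  exact h3.symm

end Tate
end CF

namespace CF

section P2a
open IsLocalRing TensorProduct

theorem tor_bc (B : Type) [CommRing B] [Algebra A B] {b : Ideal A} {M : Type} [AddCommGroup M] [Module A M]
    (h : Tor b M) : Tor (b.map (algebraMap A B)) (B ⊗[A] M) := by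
  intro v
  induction v using TensorProduct.induction_on with
  | zero => exact ⟨0, fun r _ => smul_zero r⟩
  | tmul c m =>
    obtain ⟨k, hk⟩ := h m
    refine ⟨k, ?_⟩
    rw [← Ideal.map_pow]
    intro r hr
    refine Submodule.span_induction ?_ (zero_smul _ _) ?_ ?_ hr
    · rintro _ ⟨s, hs, rfl⟩
      rw [algebraMap_smul, ← TensorProduct.tmul_smul, hk s hs, TensorProduct.tmul_zero]
    · intro x y _ _ hx hy
      rw [add_smul, hx, hy, add_zero]
    · intro d x _ hx
      rw [smul_eq_mul, mul_smul, hx, smul_zero]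
  | add x y hx hy =>
    obtain ⟨k, hk⟩ := hx
    obtain ⟨l, hl⟩ := hy
    refine ⟨k + l, fun r hr => ?_⟩
    rw [smul_add, hk r (Ideal.pow_le_pow_right (Nat.le_add_right _ _) hr),
      hl r (Ideal.pow_le_pow_right (Nat.le_add_left _ _) hr), add_zero]

variable [IsNoetherianRing A]

theorem EF_bc (B : Type) [CommRing B] [Algebra A B] [Module.Flat A B] {a : Ideal A} {M : Type}
    [AddCommGroup M] [Module A M] {i : ℕ} (h : EF A (A ⧸ a) M i) :
    EF B (B ⧸ a.map (algebraMap A B)) (B ⊗[A] M) i := by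
  obtain ⟨e⟩ := xt_baseChange (A := A) B M i (A ⧸ a)
  have : Module.Finite A (XT A (A ⧸ a) M i) := h
  have h2 : EF B (B ⊗[A] (A ⧸ a)) (B ⊗[A] M) i := Module.Finite.equiv e
  exact h2.congr_left (a.qoutMapEquivTensorQout B).symm

theorem finite_bc (B : Type) [CommRing B] [Algebra A B] [Module.Flat A B] [IsNoetherianRing B]
    {a : Ideal A} {M : Type} [AddCommGroup M] [Module A M]
    (h : ∀ i, EF B (B ⧸ a.map (algebraMap A B)) (B ⊗[A] M) i) {N : Type} [AddCommGroup N] [Module A N]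
    [Module.Finite A N] (hN : ∀ r ∈ a, ∀ n : N, r • n = 0) (i : ℕ) :
    Module.Finite B (B ⊗[A] XT A N M i) := by
  obtain ⟨e⟩ := xt_baseChange (A := A) B M i N
  have h2 : EF B (B ⊗[A] N) (B ⊗[A] M) i := by
    refine EF.of_quot i (fun i _ => h i) i le_rfl (B ⊗[A] N) ?_
    intro r hr v
    refine Submodule.span_induction ?_ (zero_smul _ _) ?_ ?_ hr
    · rintro _ ⟨s, hs, rfl⟩
      rw [algebraMap_smul]
      induction v using TensorProduct.induction_on with
      | zero => rw [smul_zero]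
      | tmul c m => rw [← TensorProduct.tmul_smul, hN s hs, TensorProduct.tmul_zero]
      | add x y hx hy => rw [smul_add, hx, hy, add_zero]
    · intro x y _ _ hx hy
      rw [add_smul, hx, hy, add_zero]
    · intro d x _ hx
      rw [smul_eq_mul, mul_smul, hx, smul_zero]
  have : Module.Finite B (XT B (B ⊗[A] N) (B ⊗[A] M) i) := h2
  exact Module.Finite.equiv e.symm

theorem exists_fg_of_away (z : A) {E : Type} [AddCommGroup E] [Module A E]
    (h : Module.Finite (Localization.Away z) (Localization.Away z ⊗[A] E)) :
    ∃ G : Submodule A E, G.FG ∧ ∀ e : E, ∃ k : ℕ, z ^ k • e ∈ G := by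
  classical
  obtain ⟨s, hs⟩ := h.fg_top
  let S := Submonoid.powers z
  let f : E →ₗ[A] Localization.Away z ⊗[A] E := TensorProduct.mk A (Localization.Away z) E 1
  have hf : IsLocalizedModule S f := inferInstance
  refine ⟨Submodule.span A (IsLocalizedModule.finsetIntegerMultiple S f s), ⟨_, rfl⟩, fun e => ?_⟩
  obtain ⟨⟨_, k, rfl⟩, ht⟩ := multiple_mem_span_of_mem_localization_span S (Localization.Away z) (s : Set _) (f e)
    (by rw [hs]; trivial)
  have ht' : f (z ^ k • e) ∈ Submodule.span A (s : Set (Localization.Away z ⊗[A] E)) := by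
    rw [map_smul]; exact ht
  obtain ⟨⟨_, l, rfl⟩, hl⟩ := IsLocalizedModule.smul_mem_finsetIntegerMultiple_span S f _ s ht'
  refine ⟨l + k, ?_⟩
  rw [pow_add, mul_smul]
  exact hl

theorem loc_fin [IsLocalRing A] {a b : Ideal A} (hab : a ≤ b)
    (hch : ∀ p₀ p₁ p₂ p₃ : Ideal A, p₀.IsPrime → p₁.IsPrime → p₂.IsPrime → p₃.IsPrime →
      b ≤ p₀ → p₀ < p₁ → p₁ < p₂ → p₂ < p₃ → False)
    {M : Type} [AddCommGroup M] [Module A M] (hb : Tor b M)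
    (h : ∀ i ≤ 2, EF A (A ⧸ a) M i) {z : A} (hz : z ∈ maximalIdeal A)
    {N : Type} [AddCommGroup N] [Module A N]
    [Module.Finite A N] (hN : ∀ r ∈ a, ∀ n : N, r • n = 0) (i : ℕ) :
    ∃ G : Submodule A (XT A N M i), G.FG ∧ ∀ e : XT A N M i, ∃ k : ℕ, z ^ k • e ∈ G := by
  let B := Localization.Away z
  have hBn : IsNoetherianRing B := IsLocalization.isNoetherianRing (Submonoid.powers z) B inferInstance
  have hflat : Module.Flat A B := IsLocalization.flat B (Submonoid.powers z)
  refine exists_fg_of_away z (finite_bc B (a := a) ?_ hN i)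
  refine P1 (b := b.map (algebraMap A B)) ?_ ?_ (tor_bc B hb) (EF_bc B (h 0 (by omega))) (EF_bc B (h 1 (by omega)))
  · intro m _ hm
    exact (Ideal.map_mono hab).trans hm
  · intro p₀ p₁ p₂ h0 h1 h2 hle h01 h12
    let φ := IsLocalization.orderEmbedding (Submonoid.powers z) B
    have hφ : ∀ I, φ I = I.comap (algebraMap A B) := fun _ => rfl
    refine hch (φ p₀) (φ p₁) (φ p₂) (maximalIdeal A) ?_ ?_ ?_ inferInstance ?_ (φ.lt_iff_lt.2 h01)
      (φ.lt_iff_lt.2 h12) ?_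
    · rw [hφ]; infer_instance
    · rw [hφ]; infer_instance
    · rw [hφ]; infer_instance
    · exact Ideal.map_le_iff_le_comap.1 hle
    · have hp2 : (φ p₂).IsPrime := by rw [hφ]; infer_instance
      refine lt_of_le_of_ne (IsLocalRing.le_maximalIdeal hp2.ne_top) fun heq => ?_
      have hzp : z ∈ φ p₂ := by rw [heq]; exact hz
      exact h2.ne_top (Ideal.eq_top_of_isUnit_mem _ hzp (IsLocalization.Away.algebraMap_isUnit z))

end P2a
end CF

namespace CF

section P2b
open IsLocalRing

variable [IsNoetherianRing A] [IsLocalRing A]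

/-- finitely generated torsion modules are killed by a power -/
theorem Tor.exists_pow {a : Ideal A} {M : Type} [AddCommGroup M] [Module A M] [Module.Finite A M] (h : Tor a M) :
    ∃ e : ℕ, ∀ r ∈ a ^ e, ∀ m : M, r • m = 0 := by
  classical
  obtain ⟨s, hs⟩ := Module.Finite.fg_top (R := A) (M := M)
  choose k hk using h
  refine ⟨s.sup k, fun r hr m => ?_⟩
  have hm : m ∈ Submodule.span A (s : Set M) := by rw [hs]; trivial
  refine Submodule.span_induction ?_ (smul_zero _) ?_ ?_ hm
  · intro x hx
    exact hk x r (Ideal.pow_le_pow_right (Finset.le_sup hx) hr)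
  · intro x y _ _ hx hy
    rw [smul_add, hx, hy, add_zero]
  · intro c x _ hx
    rw [smul_comm, hx, smul_zero]

theorem finite_ker_of_injective {M M' : Type} [AddCommGroup M] [Module A M] [AddCommGroup M'] [Module A M']
    (f : M →ₗ[A] M') (hf : Function.Injective f) (x : A)
    (h : Module.Finite A (LinearMap.ker (LinearMap.lsmul A M' x))) :
    Module.Finite A (LinearMap.ker (LinearMap.lsmul A M x)) := by
  have : IsNoetherian A (LinearMap.ker (LinearMap.lsmul A M' x)) := isNoetherian_of_isNoetherianRing_of_finite A _
  let g : LinearMap.ker (LinearMap.lsmul A M x) →ₗ[A] LinearMap.ker (LinearMap.lsmul A M' x) :=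
    (f ∘ₗ Submodule.subtype _).codRestrict _ (by
      rintro ⟨m, hm⟩
      have hm' : x • m = 0 := hm
      change x • f m = 0
      rw [← map_smul, hm', map_zero])
  refine Module.Finite.of_injective g ?_
  rintro ⟨u, hu⟩ ⟨v, hv⟩ huv
  exact Subtype.ext (hf (congrArg Subtype.val huv))

theorem finite_of_tors [IsAdicComplete (maximalIdeal A) A] {p p₀ p₁ p₂ : Ideal A} (h0 : p₀.IsPrime)
    (h1 : p₁.IsPrime) (h2 : p₂.IsPrime) (hp : p ≤ p₀) (h01 : p₀ < p₁) (h12 : p₁ < p₂)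
    {T : Type} [AddCommGroup T] [Module A T] (hm : Tor (maximalIdeal A) T)
    (hT : ∀ x ∉ p, Module.Finite A (LinearMap.ker (LinearMap.lsmul A T x))) : Module.Finite A T := by
  obtain ⟨x, hx1, hx0⟩ := Set.exists_of_ssubset h01
  obtain ⟨z, hz2, hz1⟩ := Set.exists_of_ssubset h12
  have hxm : x ∈ maximalIdeal A := IsLocalRing.le_maximalIdeal h1.ne_top hx1
  have hzm : z ∈ maximalIdeal A := IsLocalRing.le_maximalIdeal h2.ne_top hz2
  have hxtor : ∀ t : T, ∃ k : ℕ, x ^ k • t = 0 := fun t => by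
    obtain ⟨k, hk⟩ := hm t
    exact ⟨k, hk _ (Ideal.pow_mem_pow hxm k)⟩
  have hxp : ∀ k : ℕ, x ^ k ∉ p := fun k hk => hx0 (h0.mem_of_pow_mem k (hp hk))
  have hkx := hT x (by simpa using hxp 1)
  obtain ⟨e, he⟩ := Tor.exists_pow (Tor.of_inj _ (Submodule.injective_subtype (LinearMap.ker (LinearMap.lsmul A T x))) hm)
  have hart : IsArtinian A T := by
    refine artinian_of_ker hxtor (artinian_of_killed (c := maximalIdeal A ^ e) ?_ he)
    intro q hq hle
    have : maximalIdeal A ≤ q := fun r hr => hq.mem_of_pow_mem e (hle (Ideal.pow_mem_pow hr e))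
    rw [← (IsLocalRing.maximalIdeal.isMaximal A).eq_of_le hq.ne_top this]
    infer_instance
  let R : ℕ → Submodule A T := fun k => LinearMap.range (LinearMap.lsmul A T (x ^ k))
  have hR : Antitone R := antitone_nat_of_succ_le fun k => by
    rintro _ ⟨t, rfl⟩
    refine ⟨x • t, ?_⟩
    change x ^ k • x • t = x ^ (k + 1) • t
    rw [smul_smul, ← pow_succ]
  obtain ⟨k, hk⟩ := monotone_stabilizes_iff_artinian.2 hart ⟨fun k => OrderDual.toDual (R k), hR⟩
  have hk1 : R k = R (k + 1) := hk (k + 1) (by omega)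
  have hs : ∀ t : R k, ∃ s, x • s = t := by
    rintro ⟨t, ht⟩
    rw [hk1] at ht
    obtain ⟨u, rfl⟩ := ht
    exact ⟨⟨x ^ k • u, u, rfl⟩, Subtype.ext (by simp [smul_smul, pow_succ'])⟩
  obtain ⟨K, c, hd⟩ := exists_kill (T := R k) hxm hzm
    (finite_ker_of_injective _ (Submodule.injective_subtype _) x hkx) (e := e)
    (by
      rintro r hr ⟨t, ht⟩ hxt
      have := he r hr ⟨t, congrArg Subtype.val hxt⟩
      have h3 : r • t = 0 := congrArg Subtype.val this
      exact Subtype.ext h3) hs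
    (by
      rintro ⟨t, ht⟩
      obtain ⟨l, hl⟩ := hxtor t
      exact ⟨l, Subtype.ext hl⟩)
  have hdp : z ^ K + x * c ∉ p := fun hdp => hz1 (h1.mem_of_pow_mem K
    ((p₁.add_mem_iff_left (p₁.mul_mem_right c hx1)).1 (h01.le (hp hdp))))
  have hRfin : (R k).FG := by
    have h3 := hT _ hdp
    have : IsNoetherian A (LinearMap.ker (LinearMap.lsmul A T (z ^ K + x * c))) :=
      isNoetherian_of_isNoetherianRing_of_finite A _
    have hle : R k ≤ LinearMap.ker (LinearMap.lsmul A T (z ^ K + x * c)) := fun t ht =>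
      congrArg Subtype.val (hd ⟨t, ht⟩)
    exact Module.Finite.iff_fg.1 (Module.Finite.of_injective _ (Submodule.inclusion_injective hle))
  have hR0 : R k = ⊥ := by
    refine Submodule.eq_bot_of_le_smul_of_le_jacobson_bot (maximalIdeal A) (R k) hRfin ?_
      (IsLocalRing.maximalIdeal_le_jacobson _)
    intro t ht
    obtain ⟨s, hs⟩ := hs ⟨t, ht⟩
    have : t = x • s.1 := (congrArg Subtype.val hs).symm
    rw [this]
    exact Submodule.smul_mem_smul hxm s.2
  have := hT _ (hxp k)
  refine Module.Finite.of_surjective (Submodule.subtype (LinearMap.ker (LinearMap.lsmul A T (x ^ k)))) ?_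
  intro t
  refine ⟨⟨t, ?_⟩, rfl⟩
  have : x ^ k • t ∈ R k := ⟨t, rfl⟩
  rw [hR0] at this
  exact this

theorem finite_ker_quot {E : Type} [AddCommGroup E] [Module A E] {G : Submodule A E} (hG : G.FG) {x : A}
    (h : Module.Finite A (LinearMap.ker (LinearMap.lsmul A E x))) :
    Module.Finite A (LinearMap.ker (LinearMap.lsmul A (E ⧸ G) x)) := by
  let K : Submodule A E := G.comap (LinearMap.lsmul A E x)
  have hGf : Module.Finite A G := Module.Finite.iff_fg.2 hG
  have hK : Module.Finite A K := by
    refine finite_of_ker (X := LinearMap.ker (LinearMap.lsmul A E x)) (Z := G)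
      (Submodule.inclusion (by intro e he; change x • e ∈ G; rw [show x • e = 0 from he]; exact G.zero_mem))
      ((LinearMap.lsmul A E x ∘ₗ K.subtype).codRestrict G (fun e => e.2)) h ?_ hGf
    rintro ⟨e, he⟩ h0
    exact ⟨⟨e, congrArg Subtype.val h0⟩, rfl⟩
  refine Module.Finite.of_surjective ((G.mkQ ∘ₗ K.subtype).codRestrict (LinearMap.ker (LinearMap.lsmul A (E ⧸ G) x)) ?_) ?_
  · rintro ⟨e, he⟩
    change x • G.mkQ e = 0
    rw [← map_smul]
    exact (Submodule.Quotient.mk_eq_zero _).2 he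
  · rintro ⟨q, hq⟩
    obtain ⟨e, rfl⟩ := G.mkQ_surjective q
    have h1 : x • G.mkQ e = 0 := hq
    rw [← map_smul] at h1
    have h2 : x • e ∈ G := (Submodule.Quotient.mk_eq_zero G).1 h1
    exact ⟨⟨e, h2⟩, rfl⟩

/-- the dimension two theorem over complete local rings -/
theorem P2c [IsAdicComplete (maximalIdeal A) A] {a b : Ideal A} (hab : a ≤ b)
    (hch : ∀ p₀ p₁ p₂ p₃ : Ideal A, p₀.IsPrime → p₁.IsPrime → p₂.IsPrime → p₃.IsPrime →
      b ≤ p₀ → p₀ < p₁ → p₁ < p₂ → p₂ < p₃ → False)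
    {M : Type} [AddCommGroup M] [Module A M] (hb : Tor b M)
    (h : ∀ i ≤ 2, EF A (A ⧸ a) M i) : ∀ i, EF A (A ⧸ a) M i := by
  classical
  suffices key : ∀ p : Ideal A, p.IsPrime → a ≤ p → ∀ i, EF A (A ⧸ p) M i from
    EF.of_primes key (A ⧸ a) (quot_killed a)
  intro p
  induction p using WellFoundedGT.induction with
  | _ p ih =>
  intro hp hap
  have hNa : ∀ r ∈ a, ∀ n : A ⧸ p, r • n = 0 := fun r hr => quot_killed p r (hap hr)
  by_cases hchp : ∀ p₀ p₁ p₂ : Ideal A, p₀.IsPrime → p₁.IsPrime → p₂.IsPrime → p ≤ p₀ → p₀ < p₁ → p₁ < p₂ → False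
  · exact lemmaA hp hchp hch hb fun i hi => EF.of_quot 2 h i hi (A ⧸ p) hNa
  push Not at hchp
  obtain ⟨p₀, p₁, p₂, h0, h1, h2, hpp, h01, h12, -⟩ := hchp
  intro i
  have hker : ∀ x ∉ p, Module.Finite A (LinearMap.ker (LinearMap.lsmul A (XT A (A ⧸ p) M i) x)) := by
    intro x hx
    let f : (A ⧸ p) →ₗ[A] (A ⧸ p) := LinearMap.lsmul A (A ⧸ p) x
    have hf : Function.Injective f := by
      rw [injective_iff_map_eq_zero]
      intro q hq
      obtain ⟨r, rfl⟩ := Ideal.Quotient.mk_surjective q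
      have h3 : Ideal.Quotient.mk p (x * r) = 0 := hq
      rw [Ideal.Quotient.eq_zero_iff_mem] at h3 ⊢
      exact (hp.mem_or_mem h3).resolve_left hx
    have hses := ses_range f hf
    have hQ : EF A ((A ⧸ p) ⧸ LinearMap.range f) M i := by
      refine EF.of_primes (a := p ⊔ Ideal.span {x}) ?_ _ ?_ i
      · intro q hq hle
        refine ih q (lt_of_le_of_ne (le_sup_left.trans hle) ?_) hq (hap.trans (le_sup_left.trans hle))
        rintro rfl
        exact hx (hle (Ideal.mem_sup_right (Ideal.mem_span_singleton_self x)))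
      · intro r hr q
        obtain ⟨n, rfl⟩ := Submodule.mkQ_surjective _ q
        obtain ⟨s, hs, t, ht, rfl⟩ := Submodule.mem_sup.1 hr
        obtain ⟨c, rfl⟩ := Ideal.mem_span_singleton'.1 ht
        rw [← map_smul, add_smul, quot_killed p s hs, zero_add, Submodule.mkQ_apply, Submodule.Quotient.mk_eq_zero]
        exact ⟨c • n, by simp [f, smul_smul, mul_comm]⟩
    have hpre : ∀ e : XT A (A ⧸ p) M i, pre M f i e = x • e := by
      intro e
      have : f = x • LinearMap.id := by ext; rfl
      rw [this, pre_smul, LinearMap.smul_apply, pre_id]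
    have hQf : Module.Finite A (XT A ((A ⧸ p) ⧸ LinearMap.range f) M i) := hQ
    have hN : IsNoetherian A (XT A ((A ⧸ p) ⧸ LinearMap.range f) M i) := isNoetherian_of_isNoetherianRing_of_finite A _
    have hle : LinearMap.ker (LinearMap.lsmul A (XT A (A ⧸ p) M i) x) ≤
        LinearMap.range (pre M (LinearMap.range f).mkQ i) := by
      intro e he
      obtain ⟨y, hy⟩ := hses.ex2' i e (by rw [hpre]; exact he)
      exact ⟨y, hy⟩
    have : IsNoetherian A (LinearMap.range (pre M (LinearMap.range f).mkQ i)) := isNoetherian_of_isNoetherianRing_of_finite A _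
    exact Module.Finite.of_injective _ (Submodule.inclusion_injective hle)
  have hloc : ∀ z ∈ maximalIdeal A, ∃ G : Submodule A (XT A (A ⧸ p) M i), G.FG ∧
      ∀ e : XT A (A ⧸ p) M i, ∃ k : ℕ, z ^ k • e ∈ G := fun z hz => loc_fin hab hch hb h hz hNa i
  have hG : ∃ G : Submodule A (XT A (A ⧸ p) M i), G.FG ∧ Tor (maximalIdeal A) (XT A (A ⧸ p) M i ⧸ G) := by
    obtain ⟨s, hs⟩ := (maximalIdeal A).fg_of_isNoetherianRing
    have key : ∀ s : Finset A, (∀ z ∈ s, z ∈ maximalIdeal A) →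
        ∃ G : Submodule A (XT A (A ⧸ p) M i), G.FG ∧ Tor (Ideal.span (s : Set A)) (XT A (A ⧸ p) M i ⧸ G) := by
      intro s
      induction s using Finset.induction_on with
      | empty =>
        intro _
        exact ⟨⊥, Submodule.fg_bot, fun m => ⟨1, fun r hr => by
          simp only [Finset.coe_empty, Ideal.span_empty, pow_one, Submodule.mem_bot] at hr
          rw [hr, zero_smul]⟩⟩
      | insert z s hz ihs =>
        intro hzs
        obtain ⟨G, hGf, hGt⟩ := ihs fun w hw => hzs w (Finset.mem_insert_of_mem hw)
        obtain ⟨G', hGf', hGt'⟩ := hloc z (hzs z (Finset.mem_insert_self z s))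
        refine ⟨G' ⊔ G, hGf'.sup hGf, ?_⟩
        rw [Finset.coe_insert, Ideal.span_insert]
        refine Tor.sup (Tor.span ?_) (Tor.of_surj (Submodule.factor (le_sup_right : G ≤ G' ⊔ G)) (Submodule.factor_surjective _) hGt)
        intro q
        obtain ⟨e, rfl⟩ := Submodule.mkQ_surjective _ q
        obtain ⟨k, hk⟩ := hGt' e
        refine ⟨k, ?_⟩
        rw [← map_smul, Submodule.mkQ_apply, Submodule.Quotient.mk_eq_zero]
        exact Submodule.mem_sup_left hk
    rw [← hs]
    exact key s fun z hz => by rw [← hs]; exact Submodule.subset_span hz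
  obtain ⟨G, hGf, hGt⟩ := hG
  have hT : Module.Finite A (XT A (A ⧸ p) M i ⧸ G) :=
    finite_of_tors h0 h1 h2 hpp h01 h12 hGt fun x hx => finite_ker_quot hGf (hker x hx)
  have : Module.Finite A G := Module.Finite.iff_fg.2 hGf
  exact Module.Finite.of_submodule_quotient G

end P2b
end CF

namespace CF
open IsLocalRing

/-- completions of noetherian local rings are noetherian -/
theorem completion_noeth [IsNoetherianRing A] [IsLocalRing A] :
    IsNoetherianRing (AdicCompletion (maximalIdeal A) A) := by
  classical
  obtain ⟨r, y, hy⟩ := Submodule.fg_iff_exists_fin_generating_family.1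
    (maximalIdeal A).fg_of_isNoetherianRing
  let S := MvPolynomial (Fin r) A
  let J : Ideal S := MvPolynomial.idealOfVars (Fin r) A
  let m := maximalIdeal A
  let f : S →+* A := (MvPolynomial.aeval y : S →ₐ[A] A).toRingHom
  have hfX : ∀ i, f (MvPolynomial.X i) = y i := fun i => MvPolynomial.aeval_X y i
  have hfC : ∀ c, f (MvPolynomial.C c) = c := fun c =>
    MvPolynomial.aeval_C (R := A) y c
  have hJm : J.map f = m := by
    change (Ideal.span (Set.range MvPolynomial.X)).map f = m
    rw [Ideal.map_span, ← Set.range_comp]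
    refine Eq.trans ?_ hy
    congr 2
    funext i
    exact hfX i
  have hJn : ∀ n, J ^ n ≤ (m ^ n).comap f := fun n => by
    rw [← Ideal.map_le_iff_le_comap, Ideal.map_pow, hJm]
  have hJfg : J.FG := MvPolynomial.idealOfVars_fg (Fin r) A
  let g : (n : ℕ) → AdicCompletion J S →+* A ⧸ m ^ n := fun n =>
    (Ideal.quotientMap (m ^ n) f (hJn n)).comp (AdicCompletion.evalₐ J n : _ →+* _)
  have hg : ∀ {k n : ℕ} (hle : k ≤ n), (Ideal.Quotient.factorPow m hle).comp (g n) = g k := by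
    intro k n hle
    ext x
    obtain ⟨x, rfl⟩ := AdicCompletion.mk_surjective J S x
    simp only [g, RingHom.comp_apply, RingHom.coe_coe, AdicCompletion.evalₐ_mk,
      Ideal.quotientMap_mk]
    have h5 := congrArg (Ideal.quotientMap (m ^ k) f (hJn k)) (AdicCompletion.Ideal.mk_eq_mk J hle x)
    rw [Ideal.quotientMap_mk, Ideal.quotientMap_mk] at h5
    exact h5
  let ψ : AdicCompletion J S →+* AdicCompletion m A := AdicCompletion.liftRingHom m g hg
  have hψ : ∀ s : S, ψ (algebraMap S _ s) = algebraMap A _ (f s) := by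
    intro s
    refine AdicCompletion.ext_evalₐ fun n => ?_
    simp only [ψ, AdicCompletion.evalₐ_liftRingHom, g, RingHom.comp_apply, RingHom.coe_coe,
      AlgHom.commutes]
    rfl
  have hmap : (J.map (algebraMap S (AdicCompletion J S))).map ψ =
      m.map (algebraMap A (AdicCompletion m A)) := by
    have h6 : ψ.comp (algebraMap S (AdicCompletion J S)) =
        (algebraMap A (AdicCompletion m A)).comp f := RingHom.ext hψ
    rw [Ideal.map_map, h6, ← Ideal.map_map, hJm]
  have hc1 : IsAdicComplete (J.map (algebraMap S (AdicCompletion J S))) (AdicCompletion J S) :=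
    AdicCompletion.isAdicComplete_self J hJfg
  have hc2 : IsAdicComplete (m.map (algebraMap A (AdicCompletion m A))) (AdicCompletion m A) :=
    AdicCompletion.isAdicComplete_self m (maximalIdeal A).fg_of_isNoetherianRing
  have hsurj : Function.Surjective ψ := by
    have : IsHausdorff ((J.map (algebraMap S (AdicCompletion J S))).map ψ) (AdicCompletion m A) := by
      rw [hmap]; infer_instance
    refine surjective_of_mk_map_comp_surjective (I := J.map (algebraMap S (AdicCompletion J S))) ψ ?_
    intro q
    obtain ⟨q, rfl⟩ := Ideal.Quotient.mk_surjective q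
    obtain ⟨c, hc⟩ := Ideal.Quotient.mk_surjective (AdicCompletion.evalOneₐ m q)
    refine ⟨algebraMap S _ (MvPolynomial.C c), ?_⟩
    rw [RingHom.comp_apply, hψ, hfC, Ideal.Quotient.eq, hmap,
      ← AdicCompletion.ker_evalOneₐ_eq_map m (maximalIdeal A).fg_of_isNoetherianRing]
    rw [RingHom.mem_ker, map_sub, sub_eq_zero]
    exact hc
  have hN : IsNoetherianRing (AdicCompletion J S) :=
    isNoetherianRing_of_surjective (MvPowerSeries (Fin r) A) _
      (MvPowerSeries.toAdicCompletionAlgEquiv (Fin r) A).toRingEquiv.toRingHom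
      (MvPowerSeries.toAdicCompletionAlgEquiv (Fin r) A).surjective
  exact isNoetherianRing_of_surjective _ _ ψ hsurj

/-- system of parameters -/
theorem exists_sop [IsNoetherianRing A] [IsLocalRing A] {b : Ideal A} (hb : b ≠ ⊤)
    (hdim : ringKrullDim (A ⧸ b) ≤ 2) :
    ∃ s : Finset A, s.card ≤ 2 ∧ (∀ z ∈ s, z ∈ maximalIdeal A) ∧
      maximalIdeal A ≤ (b ⊔ Ideal.span (s : Set A)).radical := by
  classical
  have : Nontrivial (A ⧸ b) := Ideal.Quotient.nontrivial_iff.2 hb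
  have hloc : IsLocalRing (A ⧸ b) := IsLocalRing.of_surjective' _ Ideal.Quotient.mk_surjective
  obtain ⟨s, hs, hcard⟩ := Ideal.exists_finset_card_eq_height_of_isNoetherianRing (maximalIdeal (A ⧸ b))
  have h1 := IsLocalRing.maximalIdeal_height_eq_ringKrullDim (R := A ⧸ b)
  rw [← h1, ← hcard] at hdim
  have hc2 : s.card ≤ 2 := by
    have h7 : ((s.card : ℕ∞) : WithBot ℕ∞) ≤ ((2 : ℕ∞) : WithBot ℕ∞) := hdim
    rw [WithBot.coe_le_coe] at h7
    exact_mod_cast h7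
  let g : A ⧸ b → A := Function.surjInv (Ideal.Quotient.mk_surjective (I := b))
  have hg : ∀ z, Ideal.Quotient.mk b (g z) = z := Function.surjInv_eq Ideal.Quotient.mk_surjective
  refine ⟨s.image g, Finset.card_image_le.trans hc2, ?_, ?_⟩
  · intro z hz
    obtain ⟨w, hw, rfl⟩ := Finset.mem_image.1 hz
    rw [IsLocalRing.mem_maximalIdeal, mem_nonunits_iff]
    intro hu
    have h8 := hu.map (Ideal.Quotient.mk b)
    rw [hg] at h8
    exact (hs.1.2 (Ideal.subset_span hw) : w ∈ maximalIdeal (A ⧸ b)) h8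
  rw [Ideal.radical_eq_sInf]
  refine le_sInf ?_
  rintro q ⟨hq, hqp⟩
  have hbq : b ≤ q := le_sup_left.trans hq
  have hprime : (q.map (Ideal.Quotient.mk b)).IsPrime :=
    Ideal.isPrime_map_quotientMk_of_isPrime hbq
  have hsle : Ideal.span (s : Set (A ⧸ b)) ≤ q.map (Ideal.Quotient.mk b) := by
    rw [Ideal.span_le]
    intro z hz
    have : g z ∈ q :=
      hq (le_sup_right (a := b) (Ideal.subset_span (by
        simp only [Finset.coe_image]; exact ⟨z, hz, rfl⟩)))
    have h2 := Ideal.mem_map_of_mem (Ideal.Quotient.mk b) this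
    rwa [hg] at h2
  have hle := hs.2 ⟨hprime, hsle⟩ (IsLocalRing.le_maximalIdeal hprime.ne_top)
  intro z hz
  have hz' : Ideal.Quotient.mk b z ∈ maximalIdeal (A ⧸ b) := by
    exact ((IsLocalRing.local_hom_TFAE (Ideal.Quotient.mk b)).out 0 4).1
      (IsLocalHom.of_surjective _ Ideal.Quotient.mk_surjective) |> fun h => by
        rw [← h] at hz; exact hz
  have h3 := hle hz'
  have h4 : z ∈ (q.map (Ideal.Quotient.mk b)).comap (Ideal.Quotient.mk b) := h3
  rwa [Ideal.comap_map_mk hbq] at h4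

/-- a quotient of a local ring by `b` plus two parameters bounds chains -/
theorem no_chain {B : Type} [CommRing B] [IsNoetherianRing B] [IsLocalRing B] {b : Ideal B}
    (s : Finset B) (hs : s.card ≤ 2) (hsm : ∀ z ∈ s, z ∈ maximalIdeal B)
    (hm : maximalIdeal B ≤ (b ⊔ Ideal.span (s : Set B)).radical)
    (p₀ p₁ p₂ p₃ : Ideal B) (h0 : p₀.IsPrime) (h1 : p₁.IsPrime) (h2 : p₂.IsPrime) (h3 : p₃.IsPrime)
    (hb : b ≤ p₀) (h01 : p₀ < p₁) (h12 : p₁ < p₂) (h23 : p₂ < p₃) : False := by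
  classical
  let π := Ideal.Quotient.mk p₀
  have key : ∀ p : Ideal B, p.IsPrime → p₀ ≤ p → (p.map π).IsPrime ∧ (p.map π).comap π = p :=
    fun p hp hle => ⟨Ideal.isPrime_map_quotientMk_of_isPrime hle, Ideal.comap_map_mk hle⟩
  have klt : ∀ p q : Ideal B, p₀ ≤ p → p.IsPrime → q.IsPrime → p < q → p.map π < q.map π := by
    intro p q hp hpp hqq hpq
    refine lt_of_le_of_ne (Ideal.map_mono hpq.le) fun h => hpq.ne ?_
    rw [← (key p hpp hp).2, h, (key q hqq (hp.trans hpq.le)).2]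
  have i0 := (key p₀ h0 le_rfl).1
  have i1 := (key p₁ h1 h01.le).1
  have i2 := (key p₂ h2 (h01.trans h12).le).1
  have i3 := (key p₃ h3 (h01.trans (h12.trans h23)).le).1
  have l1 := klt _ _ le_rfl h0 h1 h01
  have l2 := klt _ _ h01.le h1 h2 h12
  have l3 := klt _ _ (h01.trans h12).le h2 h3 h23
  -- `p₃` may be assumed maximal
  have hM : (maximalIdeal B).IsPrime := inferInstance
  have hle3 : p₃ ≤ maximalIdeal B := IsLocalRing.le_maximalIdeal h3.ne_top
  have hp0M : p₀ ≤ maximalIdeal B := (h01.trans (h12.trans h23)).le.trans hle3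
  have iM := (key _ hM hp0M).1
  have lM : p₂.map π < (maximalIdeal B).map π := lt_of_lt_of_le l3 (Ideal.map_mono hle3)
  have hmin : (maximalIdeal B).map π ∈
      (Ideal.span ((s.image π : Finset (B ⧸ p₀)) : Set (B ⧸ p₀))).minimalPrimes := by
    refine ⟨⟨iM, ?_⟩, ?_⟩
    · rw [Ideal.span_le]
      intro z hz
      obtain ⟨w, hw, rfl⟩ := Finset.mem_image.1 hz
      exact Ideal.mem_map_of_mem π (hsm w hw)
    · rintro q ⟨hq, hle⟩ -
      rw [Ideal.map_le_iff_le_comap]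
      have hqc : (q.comap π).IsPrime := Ideal.comap_isPrime π q
      refine hm.trans (hqc.radical_le_iff.2 (sup_le ?_ ?_))
      · intro z hz
        have : π z = 0 := Ideal.Quotient.eq_zero_iff_mem.2 (hb hz)
        rw [Ideal.mem_comap, this]
        exact q.zero_mem
      · rw [Ideal.span_le]
        intro z hz
        exact hle (Ideal.subset_span (Finset.mem_coe.2 (Finset.mem_image_of_mem π hz)))
  have h4 := Ideal.height_le_card_of_mem_minimalPrimes_span (Finset.finite_toSet _) hmin
  rw [Set.ncard_coe_finset] at h4
  have h5 : ((s.image π).card : ℕ∞) ≤ 2 := by exact_mod_cast Finset.card_image_le.trans hs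
  have h6 := Ideal.height_add_one_le_of_lt_of_isPrime l1
  have h7 := Ideal.height_add_one_le_of_lt_of_isPrime l2
  have h8 := Ideal.height_add_one_le_of_lt_of_isPrime lM
  have h9 : (3 : ℕ∞) ≤ 2 := calc
    (3 : ℕ∞) = 0 + 1 + 1 + 1 := by norm_num
    _ ≤ (p₀.map π).height + 1 + 1 + 1 := by gcongr; exact bot_le
    _ ≤ (p₁.map π).height + 1 + 1 := by gcongr
    _ ≤ (p₂.map π).height + 1 := by gcongr
    _ ≤ _ := h8
    _ ≤ _ := h4
    _ ≤ 2 := h5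
  exact absurd h9 (by norm_num)

end CF

namespace CF
open IsLocalRing

/-- the dimension two theorem -/
theorem P2 [IsNoetherianRing A] [IsLocalRing A] {a b : Ideal A} (hab : a ≤ b) (hbt : b ≠ ⊤)
    (hdim : ringKrullDim (A ⧸ b) ≤ 2)
    {M : Type} [AddCommGroup M] [Module A M] (hb : Tor b M)
    (h : ∀ i ≤ 2, EF A (A ⧸ a) M i) : ∀ i, EF A (A ⧸ a) M i := by
  classical
  let B := AdicCompletion (maximalIdeal A) A
  have hN : IsNoetherianRing B := completion_noeth
  have hfl : Module.Flat A B := AdicCompletion.flat_of_isNoetherian _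
  have hff : Module.FaithfullyFlat A B := Module.FaithfullyFlat.of_flat_of_isLocalHom
  obtain ⟨s, hs, hsm, hrad⟩ := exists_sop hbt hdim
  have hmB : maximalIdeal B = (maximalIdeal A).map (algebraMap A B) :=
    AdicCompletion.maximalIdeal_eq_map
  have hch := no_chain (b := b.map (algebraMap A B)) (s.image (algebraMap A B))
    (Finset.card_image_le.trans hs)
    (by
      intro z hz
      obtain ⟨w, hw, rfl⟩ := Finset.mem_image.1 hz
      rw [hmB]
      exact Ideal.mem_map_of_mem _ (hsm w hw))
    (by
      rw [hmB, Ideal.map_le_iff_le_comap]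
      refine hrad.trans ?_
      have he : b.map (algebraMap A B) ⊔ Ideal.span ((s.image (algebraMap A B) : Finset B) : Set B) =
          (b ⊔ Ideal.span (s : Set A)).map (algebraMap A B) := by
        rw [Ideal.map_sup, Ideal.map_span, Finset.coe_image]
      rw [he, Ideal.comap_radical]
      exact Ideal.radical_mono Ideal.le_comap_map)
  have key := P2c (A := B) (a := a.map (algebraMap A B)) (Ideal.map_mono hab) hch (tor_bc B hb)
    (fun i hi => EF_bc B (h i hi))
  intro i
  have := finite_bc B key (quot_killed a) i
  exact Module.Finite.of_finite_tensorProduct_of_faithfullyFlat B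

theorem EF_of_dim_three [IsNoetherianRing A] [IsLocalRing A] {a : Ideal A} (hat : a ≠ ⊤)
    (hdim : ringKrullDim A = 3)
    {M : Type} [AddCommGroup M] [Module A M] (ha : Tor a M)
    (h : ∀ i ≤ 2, EF A (A ⧸ a) M i) : ∀ i, EF A (A ⧸ a) M i := by
  classical
  let G : ℕ →o Ideal A := ⟨fun k => Submodule.torsionBySet A A ((a ^ k : Ideal A) : Set A), by
    intro k l hkl s hs
    rw [Submodule.mem_torsionBySet_iff] at hs ⊢
    rintro ⟨r, hr⟩
    exact hs ⟨r, Ideal.pow_le_pow_right hkl hr⟩⟩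
  have hGm : ∀ k s, s ∈ G k ↔ ∀ r ∈ a ^ k, r * s = 0 := fun k s => by
    change s ∈ Submodule.torsionBySet A A ((a ^ k : Ideal A) : Set A) ↔ _
    rw [Submodule.mem_torsionBySet_iff]
    exact ⟨fun h r hr => h ⟨r, hr⟩, fun h r => h r.1 r.2⟩
  obtain ⟨n, hn⟩ := monotone_stabilizes_iff_noetherian.2 (inferInstance : IsNoetherian A A) G
  have hGn : ∀ k s, s ∈ G k → s ∈ G n := by
    intro k s hs
    rw [hn (max n k) (le_max_left _ _)]
    exact G.monotone (le_max_right _ _) hs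
  obtain ⟨l, g, hg⟩ := Submodule.fg_iff_exists_fin_generating_family.1
    (G n).fg_of_isNoetherianRing
  have hgG : ∀ i, g i ∈ G n := fun i => by rw [← hg]; exact Submodule.subset_span ⟨i, rfl⟩
  let T := Submodule.torsionBySet A M ((a ^ n : Ideal A) : Set A)
  have hT : Module.Finite A T := finite_torsion_pow (EF_zero_iff.1 (h 0 (by omega))) n
  let φ : M →ₗ[A] (Fin l → T) := LinearMap.pi fun i =>
    (LinearMap.lsmul A M (g i)).codRestrict T (by
      intro m
      rw [Submodule.mem_torsionBySet_iff]
      rintro ⟨r, hr⟩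
      change r • g i • m = 0
      rw [smul_smul, (hGm n _).1 (hgG i) r hr, zero_smul])
  let M' := LinearMap.ker φ
  have hfin : Module.Finite A (M ⧸ M') :=
    Module.Finite.of_injective (M'.liftQ φ le_rfl) (by
      rw [← LinearMap.ker_eq_bot]; exact Submodule.ker_liftQ_eq_bot _ _ _ le_rfl)
  have hkill : ∀ s ∈ G n, ∀ m ∈ M', s • m = 0 := by
    intro s hs m hm
    have hle : G n ≤ LinearMap.ker (LinearMap.toSpanSingleton A M m) := by
      rw [← hg, Submodule.span_le]
      rintro _ ⟨i, rfl⟩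
      have h1 : φ m = 0 := hm
      exact congrArg Subtype.val (congrFun h1 i)
    exact hle hs
  have hses := ses_sub M'
  have hQ : ∀ i, EF A (A ⧸ a) (M ⧸ M') i := fun i => EF.of_finite i
  have h' : ∀ i ≤ 2, EF A (A ⧸ a) M' i := by
    intro i hi
    rcases i with _ | i
    · exact EF.sub hses.inj (h 0 hi)
    · exact hses.EF1 (hQ i) (h _ hi)
  have htor : Tor (a ⊔ G n) M' := Tor.sup (Tor.of_inj _ (Submodule.injective_subtype M') ha) (by
    intro m
    refine ⟨1, fun r hr => Subtype.ext (hkill r ?_ m.1 m.2)⟩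
    rwa [pow_one] at hr)
  have hnomin : ∀ p : PrimeSpectrum A, a ⊔ G n ≤ p.asIdeal → ∃ q : PrimeSpectrum A, q < p := by
    intro p hp
    by_contra hcon
    push Not at hcon
    have hmin : p.asIdeal ∈ (⊥ : Ideal A).minimalPrimes := by
      refine ⟨⟨p.2, bot_le⟩, ?_⟩
      rintro q ⟨hq, -⟩ hle
      by_contra hlt
      exact hcon ⟨q, hq⟩ (lt_of_le_not_ge hle hlt)
    obtain ⟨s, hs, N, hN⟩ := exists_smul_of_minimal hmin (le_sup_left.trans hp) 1
    refine hs (hp (le_sup_right (a := a) (hGn N s ((hGm N s).2 fun r hr => ?_))))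
    have := hN r hr
    rw [pow_one, Ideal.mem_bot] at this
    rw [mul_comm, this]
  have hall : ∀ i, EF A (A ⧸ a) M' i := by
    by_cases hbt : a ⊔ G n = ⊤
    · have hsub : Subsingleton M' := by
        refine ⟨fun u v => ?_⟩
        obtain ⟨k, hk⟩ := htor (u - v)
        have := hk 1 (by rw [hbt, Ideal.top_pow]; trivial)
        rwa [one_smul, sub_eq_zero] at this
      exact fun i => EF.of_subsing_right i
    · refine P2 le_sup_left hbt ?_ htor h'
      refine iSup_le fun p => ?_
      let c := PrimeSpectrum.comap (Ideal.Quotient.mk (a ⊔ G n))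
      have hc : StrictMono c := by
        intro u v huv
        refine lt_of_le_not_ge (Ideal.comap_mono huv.le) fun h2 => huv.not_ge ?_
        exact (Ideal.comap_le_comap_iff_of_surjective _ Ideal.Quotient.mk_surjective _ _).1 h2
      obtain ⟨q, hq⟩ := hnomin (c p.head) (by
        intro z hz
        change Ideal.Quotient.mk (a ⊔ G n) z ∈ p.head.asIdeal
        rw [Ideal.Quotient.eq_zero_iff_mem.2 hz]
        exact Ideal.zero_mem _)
      let p' := (p.map c hc).cons q (by simpa using hq)
      have h3 : (p'.length : WithBot ℕ∞) ≤ 3 := by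
        rw [← hdim]; exact le_iSup (fun p : LTSeries (PrimeSpectrum A) => (p.length : WithBot ℕ∞)) p'
      have h4 : p'.length = p.length + 1 := by simp [p']
      rw [h4] at h3
      have h5 : ((p.length + 1 : ℕ) : WithBot ℕ∞) ≤ ((3 : ℕ) : WithBot ℕ∞) := h3
      have h6 : p.length + 1 ≤ 3 := by exact_mod_cast h5
      have h7 : p.length ≤ 2 := by omega
      exact_mod_cast h7
  exact fun i => hses.EF2 (hall i) (hQ i)

theorem Tor.of_support [IsNoetherianRing A] {a : Ideal A} {M : Type} [AddCommGroup M] [Module A M]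
    (h : Module.support A M ⊆ PrimeSpectrum.zeroLocus (a : Set A)) : Tor a M := by
  intro m
  have h1 : a ≤ (Submodule.span A {m}).annihilator.radical := by
    rw [Ideal.radical_eq_sInf]
    refine le_sInf ?_
    rintro q ⟨hq, hqp⟩
    exact h (Module.mem_support_iff_exists_annihilator.2 ⟨m, hq⟩ : (⟨q, hqp⟩ : PrimeSpectrum A) ∈ _)
  obtain ⟨k, hk⟩ := Ideal.exists_pow_le_of_le_radical_of_fg h1 a.fg_of_isNoetherianRing
  exact ⟨k, fun r hr => Submodule.mem_annihilator_span_singleton m r |>.1 (hk hr)⟩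

end CF

/-- If `A` is local with `dim A/𝔞 ≤ 2` or `dim A = 3`, `x₁, …, x_t ∈ 𝔞`,
`Supp M ⊆ V(𝔞)`, and `Ext_A^i(A/𝔞, H^j(x,M))` is finitely generated for all `i ≤ 2`
and `j ≤ 2`, then `M` is `𝔞`-cofinite. -/
theorem stmt7 [IsNoetherianRing A] [IsLocalRing A] (𝔞 : Ideal A)
    (hdim : ringKrullDim (A ⧸ 𝔞) ≤ 2 ∨ ringKrullDim A = 3)
    {t : ℕ} (x : Fin t → A) (hx : ∀ j, x j ∈ 𝔞)
    (M : Type) [AddCommGroup M] [Module A M]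
    (hsupp : Module.support A M ⊆ PrimeSpectrum.zeroLocus (𝔞 : Set A))
    (H : ∀ i ≤ 2, ∀ j ≤ 2, Module.Finite A (extQuot 𝔞 (KoszulCohomology x M j) i)) :
    IsCofinite 𝔞 M := by
  have hT := CF.Tor.of_support hsupp
  have h2 : ∀ i ≤ 2, CF.EF A (A ⧸ 𝔞) M i :=
    CF.koszul_step x M hx (CF.quot_killed 𝔞) fun i hi j hj =>
      (CF.ext_finite_iff _ _).1 (H i hi j hj)
  have hall : ∀ i, CF.EF A (A ⧸ 𝔞) M i := by
    by_cases ht : 𝔞 = ⊤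
    · have : Subsingleton (A ⧸ 𝔞) := Ideal.Quotient.subsingleton_iff.2 ht
      exact fun i => CF.EF.of_subsing_left i
    · rcases hdim with hd | hd
      · exact CF.P2 le_rfl ht hd hT h2
      · exact CF.EF_of_dim_three ht hd hT h2
  exact ⟨hsupp, fun i => (CF.ext_finite_iff _ _).2 (hall i)⟩

end
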